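/- Let V be a meromorphic open-string vertex algebra and W a V-bimodule. Then for every positive integer n, every l = 0,…,n, all u_1,…,u_n ∈ V, w ∈ W and w' ∈ W', the series ⟨w', Y_W^L(u_1,z_1)⋯Y_W^L(u_l,z_l)Y_W^{s(R)}(u_{l+1},z_{l+1})⋯Y_W^{s(R)}(u_n,z_n)w⟩ converges absolutely when |z_1|>⋯>|z_n|>0 to a rational function in z_1,…,z_n with the only possible poles at z_i = 0 (i = 1,…,n) and z_i = z_j (1 ≤ i < j ≤ n). -/

import Mathlib

set_option autoImplicit false
set_option maxHeartbeats 1000000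

open scoped BigOperators

noncomputable section

namespace VA

/-- Absolute convergence of a series of complex numbers indexed by `ι` to the sum `s`. -/
def AbsConvTo {ι : Type*} (f : ι → ℂ) (s : ℂ) : Prop :=
  Summable (fun i => ‖f i‖) ∧ HasSum f s

/-- The configuration-space condition: the entries of `z` are pairwise distinct. -/
def Conf {ι : Type*} (z : ι → ℂ) : Prop := ∀ i j : ι, i ≠ j → z i ≠ z j

/-- `‖z 0‖ > ‖z 1‖ > ⋯ > ‖z (n-1)‖`. -/
def Ordered {n : ℕ} (z : Fin n → ℂ) : Prop := ∀ i j : Fin n, i < j → ‖z j‖ < ‖z i‖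

/-- `‖z 0‖ > ‖z 1‖ > ⋯ > ‖z (n-1)‖ > 0`. -/
def OrderedPos {n : ℕ} (z : Fin n → ℂ) : Prop := Ordered z ∧ ∀ i, 0 < ‖z i‖

/-- A rational function in the variables `z i`, `i : ι`, whose only possible poles are
at `z i = 0` and on the diagonals `z i = z j` (`i ≠ j`); it is recorded as a numerator
polynomial together with the orders of the poles. -/
structure RatFn (ι : Type*) [Fintype ι] [DecidableEq ι] where
  num : MvPolynomial ι ℂ
  a : ι → ℕ
  b : ι → ι → ℕ

def RatFn.eval {ι : Type*} [Fintype ι] [DecidableEq ι] (R : RatFn ι) (z : ι → ℂ) : ℂ :=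
  MvPolynomial.eval z R.num /
    ((∏ i, z i ^ R.a i) * ∏ q ∈ Finset.univ.offDiag, (z q.1 - z q.2) ^ R.b q.1 q.2)

/-- A rational function in the variables `z i`, `i : ι`, whose only possible poles are
on the diagonals `z i = z j` (`i ≠ j`). -/
structure DiagRatFn (ι : Type*) [Fintype ι] [DecidableEq ι] where
  num : MvPolynomial ι ℂ
  b : ι → ι → ℕ

def DiagRatFn.eval {ι : Type*} [Fintype ι] [DecidableEq ι] (R : DiagRatFn ι) (z : ι → ℂ) : ℂ :=
  MvPolynomial.eval z R.num / ∏ q ∈ Finset.univ.offDiag, (z q.1 - z q.2) ^ R.b q.1 q.2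

/-- A linear functional belongs to the graded dual iff its restriction to all but
finitely many homogeneous components vanishes. -/
def InGradedDual {ι : Type*} {M : Type*} [AddCommGroup M] [Module ℂ M]
    (proj : ι → M →ₗ[ℂ] M) (φ : M →ₗ[ℂ] ℂ) : Prop :=
  (Function.support fun i => φ ∘ₗ proj i).Finite

/-- Iterated application: `compApply n f w = f 0 (f 1 (⋯ (f (n-1) w)))`. -/
def compApply {M : Type*} : (n : ℕ) → (Fin n → (M → M)) → M → M
  | 0, _, w => w
  | n+1, f, w => f 0 (compApply n (fun i => f i.succ) w)

section Graded

variable (W : Type*) [AddCommGroup W] [Module ℂ W]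

/-- A `ℂ`-grading of `W`, recorded via the projections onto the homogeneous
subspaces, whose weights have lower-bounded real parts. -/
structure CGrading where
  proj : ℂ → W →ₗ[ℂ] W
  proj_comp : ∀ m n : ℂ, proj m ∘ₗ proj n = if m = n then proj n else 0
  proj_finite : ∀ w : W, (Function.support fun n => proj n w).Finite
  proj_sum : ∀ w : W, (∑ᶠ n : ℂ, proj n w) = w
  lower_bound : ∃ B : ℝ, ∀ n : ℂ, n.re < B → proj n = 0

/-- A `ℤ`-grading of `V` with lower-bounded weights. -/
structure ZGrading where
  proj : ℤ → W →ₗ[ℂ] W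
  proj_comp : ∀ m n : ℤ, proj m ∘ₗ proj n = if m = n then proj n else 0
  proj_finite : ∀ w : W, (Function.support fun n => proj n w).Finite
  proj_sum : ∀ w : W, (∑ᶠ n : ℤ, proj n w) = w
  lower_bound : ∃ B : ℤ, ∀ n : ℤ, n < B → proj n = 0

variable {W}

/-- The grading operator `d` of a `ℂ`-graded space. -/
def CGrading.d (G : CGrading W) (w : W) : W := ∑ᶠ n : ℂ, n • G.proj n w

/-- The grading operator `d` of a `ℤ`-graded space. -/
def ZGrading.d (G : ZGrading W) (v : W) : W := ∑ᶠ n : ℤ, (n : ℂ) • G.proj n v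

/-- The operator `z^d` on a `ℤ`-graded space. -/
def ZGrading.zd (G : ZGrading W) (z : ℂ) (v : W) : W := ∑ᶠ n : ℤ, (z ^ n) • G.proj n v

/-- The algebraic completion `∏ₙ W_[n]`, realized as the submodule of functions
`ℂ → W` recording a homogeneous component in each weight. -/
def CGrading.compSub (G : CGrading W) : Submodule ℂ (ℂ → W) where
  carrier := {f | ∀ n, G.proj n (f n) = f n}
  add_mem' := by
    intro a b ha hb n
    simp only [Pi.add_apply, map_add, ha n, hb n]
  zero_mem' := by
    intro n
    simp
  smul_mem' := by
    intro c f hf n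
    simp only [Pi.smul_apply, map_smul, hf n]

/-- The algebraic completion of a graded space. -/
abbrev CGrading.Comp (G : CGrading W) : Type _ := ↥G.compSub

/-- The pairing between the graded dual and the algebraic completion. -/
def CGrading.pair (G : CGrading W) (φ : W →ₗ[ℂ] ℂ) (f : G.Comp) : ℂ :=
  ∑ᶠ n : ℂ, φ (f.1 n)

/-- The embedding of `W` into its algebraic completion. -/
def CGrading.emb (G : CGrading W) (w : W) : G.Comp :=
  ⟨fun n => G.proj n w, by
    intro n
    have h := congrArg (fun T : W →ₗ[ℂ] W => T w) (G.proj_comp n n)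
    simpa using h⟩

/-- The componentwise extension of an operator on `W` to the algebraic completion. -/
def CGrading.ext (G : CGrading W) (L : W → W) (f : G.Comp) : G.Comp :=
  ⟨fun m => ∑ᶠ n : ℂ, G.proj m (L (f.1 n)), by
    intro m
    show G.proj m (∑ᶠ n : ℂ, G.proj m (L (f.1 n))) = ∑ᶠ n : ℂ, G.proj m (L (f.1 n))
    by_cases h : (Function.support fun n => G.proj m (L (f.1 n))).Finite
    · have h1 := AddMonoidHom.map_finsum (G.proj m).toAddMonoidHom h
      simp only [LinearMap.toAddMonoidHom_coe] at h1
      rw [h1]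
      refine finsum_congr fun n => ?_
      have h2 := congrArg (fun T : W →ₗ[ℂ] W => T (L (f.1 n))) (G.proj_comp m m)
      simpa using h2
    · rw [finsum_of_infinite_support h]
      simp⟩

/-- The operator `z^d` on the algebraic completion, acting on the component of
weight `n` by `z ^ n` (complex power). -/
def CGrading.zd (G : CGrading W) (z : ℂ) (f : G.Comp) : G.Comp :=
  ⟨fun n => (z ^ n) • f.1 n, by
    intro n
    rw [map_smul, f.2 n]⟩

end Graded


section VOA

/-- A meromorphic open-string vertex algebra (MOSVA): a lower-bounded `ℤ`-graded
space with a vertex operator map (recorded through its coefficients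
`Y u v k = (Y_V)_k(u)v`, the coefficient of `x^{-k-1}` in `Y_V(u,x)v`) and a
vacuum, satisfying the grading, vacuum, `D`-derivative/commutator, rationality and
associativity axioms. -/
structure MOSVA (V : Type*) [AddCommGroup V] [Module ℂ V] where
  gr : ZGrading V
  Y : V →ₗ[ℂ] V →ₗ[ℂ] (ℤ → V)
  vac : V
  /-- lower truncation of vertex operators -/
  trunc : ∀ u v : V, ∃ N : ℤ, ∀ k : ℤ, N ≤ k → Y u v k = 0
  /-- identity property `Y(𝟏,x) = 1` -/
  identity : ∀ (v : V) (k : ℤ), Y vac v k = if k = -1 then v else 0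
  /-- creation property: `Y(u,x)𝟏 ∈ V[[x]]` and `lim_{x→0} Y(u,x)𝟏 = u` -/
  creation : ∀ (u : V) (k : ℤ), 0 ≤ k → Y u vac k = 0
  creation_lim : ∀ u : V, Y u vac (-1) = u
  /-- the `d`-commutator formula, written in terms of coefficients -/
  d_comm : ∀ (u v : V) (k : ℤ),
    gr.d (Y u v k) = Y (gr.d u) v k + (-(k : ℂ) - 1) • Y u v k + Y u (gr.d v) k
  /-- the `D`-derivative property (`D_V u = (Y_V)_{-2}(u)𝟏`) -/
  D_deriv : ∀ (u v : V) (k : ℤ),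
    Y (Y u vac (-2)) v k = (-(k : ℂ)) • Y u v (k - 1)
  /-- the `D`-commutator formula -/
  D_comm : ∀ (u v : V) (k : ℤ),
    Y (Y u v k) vac (-2) - Y u (Y v vac (-2)) k = (-(k : ℂ)) • Y u v (k - 1)
  /-- rationality of products: matrix coefficients of products of vertex operators
  converge absolutely in the ordered region to rational functions with the only
  possible poles at `z i = 0` and `z i = z j` -/
  rationality : ∀ (n : ℕ) (u : Fin n → V) (v : V) (φ : V →ₗ[ℂ] ℂ),
    InGradedDual gr.proj φ → ∃ R : RatFn (Fin n), ∀ z : Fin n → ℂ, OrderedPos z →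
      AbsConvTo (fun k : Fin n → ℤ =>
          φ (compApply n (fun i x => Y (u i) x (k i)) v) * ∏ i, z i ^ (-(k i) - 1))
        (R.eval z)
  /-- rationality of iterates and associativity: products and iterates converge to a
  common rational function -/
  associativity : ∀ (u₁ u₂ v : V) (φ : V →ₗ[ℂ] ℂ), InGradedDual gr.proj φ →
    ∃ R : RatFn (Fin 2),
      (∀ z₁ z₂ : ℂ, ‖z₂‖ < ‖z₁‖ → 0 < ‖z₂‖ →
        AbsConvTo (fun k : ℤ × ℤ =>
            φ (Y u₁ (Y u₂ v k.2) k.1) * z₁ ^ (-k.1 - 1) * z₂ ^ (-k.2 - 1))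
          (R.eval ![z₁, z₂])) ∧
      (∀ z₁ z₂ : ℂ, ‖z₁ - z₂‖ < ‖z₂‖ → 0 < ‖z₁ - z₂‖ →
        AbsConvTo (fun k : ℤ × ℤ =>
            φ (Y (Y u₁ u₂ k.1) v k.2) * (z₁ - z₂) ^ (-k.1 - 1) * z₂ ^ (-k.2 - 1))
          (R.eval ![z₁, z₂]))

variable {V : Type*} [AddCommGroup V] [Module ℂ V]

/-- The operator `D_V`. -/
def MOSVA.D (A : MOSVA V) (v : V) : V := A.Y v A.vac (-2)

/-- The pole-order condition for a MOSVA. -/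
def MOSVA.PoleOrder (A : MOSVA V) : Prop :=
  ∀ u₁ v : V, ∃ C : ℕ, ∀ φ : V →ₗ[ℂ] ℂ, InGradedDual A.gr.proj φ → ∀ u₂ : V,
    ∃ R : RatFn (Fin 2), R.a 0 ≤ C ∧
      ∀ z₁ z₂ : ℂ, ‖z₂‖ < ‖z₁‖ → 0 < ‖z₂‖ →
        AbsConvTo (fun k : ℤ × ℤ =>
            φ (A.Y u₁ (A.Y u₂ v k.2) k.1) * z₁ ^ (-k.1 - 1) * z₂ ^ (-k.2 - 1))
          (R.eval ![z₁, z₂])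

/-- A bimodule for a MOSVA: a `ℂ`-graded space with left and right vertex operator
maps (recorded through their coefficients), satisfying the left module, right module
and compatibility axioms. -/
structure Bimod (A : MOSVA V) (W : Type*) [AddCommGroup W] [Module ℂ W] where
  gr : CGrading W
  YL : V →ₗ[ℂ] W →ₗ[ℂ] (ℤ → W)
  YR : W →ₗ[ℂ] V →ₗ[ℂ] (ℤ → W)
  DW : W →ₗ[ℂ] W
  /-- `D_W` has weight one -/
  DW_wt : ∀ n : ℂ, DW ∘ₗ gr.proj n = gr.proj (n + 1) ∘ₗ DW ∘ₗ gr.proj n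
  truncL : ∀ (u : V) (w : W), ∃ N : ℤ, ∀ k : ℤ, N ≤ k → YL u w k = 0
  truncR : ∀ (w : W) (u : V), ∃ N : ℤ, ∀ k : ℤ, N ≤ k → YR w u k = 0
  identityL : ∀ (w : W) (k : ℤ), YL A.vac w k = if k = -1 then w else 0
  creationR : ∀ (w : W) (k : ℤ), 0 ≤ k → YR w A.vac k = 0
  creationR_lim : ∀ w : W, YR w A.vac (-1) = w
  d_commL : ∀ (u : V) (w : W) (k : ℤ),
    gr.d (YL u w k) = YL (A.gr.d u) w k + (-(k : ℂ) - 1) • YL u w k + YL u (gr.d w) k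
  d_commR : ∀ (w : W) (u : V) (k : ℤ),
    gr.d (YR w u k) = YR (gr.d w) u k + (-(k : ℂ) - 1) • YR w u k + YR w (A.gr.d u) k
  D_derivL : ∀ (u : V) (w : W) (k : ℤ),
    YL (A.D u) w k = (-(k : ℂ)) • YL u w (k - 1)
  D_commL : ∀ (u : V) (w : W) (k : ℤ),
    DW (YL u w k) - YL u (DW w) k = (-(k : ℂ)) • YL u w (k - 1)
  D_derivR : ∀ (w : W) (u : V) (k : ℤ),
    YR (DW w) u k = (-(k : ℂ)) • YR w u (k - 1)
  D_commR : ∀ (w : W) (u : V) (k : ℤ),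
    DW (YR w u k) - YR w (A.D u) k = (-(k : ℂ)) • YR w u (k - 1)
  /-- rationality for products of left vertex operators -/
  rationalityL : ∀ (n : ℕ) (u : Fin n → V) (w : W) (φ : W →ₗ[ℂ] ℂ),
    InGradedDual gr.proj φ → ∃ R : RatFn (Fin n), ∀ z : Fin n → ℂ, OrderedPos z →
      AbsConvTo (fun k : Fin n → ℤ =>
          φ (compApply n (fun i x => YL (u i) x (k i)) w) * ∏ i, z i ^ (-(k i) - 1))
        (R.eval z)
  /-- rationality of iterates and associativity for the left vertex operator map -/
  associativityL : ∀ (u₁ u₂ : V) (w : W) (φ : W →ₗ[ℂ] ℂ), InGradedDual gr.proj φ →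
    ∃ R : RatFn (Fin 2),
      (∀ z₁ z₂ : ℂ, ‖z₂‖ < ‖z₁‖ → 0 < ‖z₂‖ →
        AbsConvTo (fun k : ℤ × ℤ =>
            φ (YL u₁ (YL u₂ w k.2) k.1) * z₁ ^ (-k.1 - 1) * z₂ ^ (-k.2 - 1))
          (R.eval ![z₁, z₂])) ∧
      (∀ z₁ z₂ : ℂ, ‖z₁ - z₂‖ < ‖z₂‖ → 0 < ‖z₁ - z₂‖ →
        AbsConvTo (fun k : ℤ × ℤ =>
            φ (YL (A.Y u₁ u₂ k.1) w k.2) * (z₁ - z₂) ^ (-k.1 - 1) * z₂ ^ (-k.2 - 1))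
          (R.eval ![z₁, z₂]))
  /-- rationality for products `Y_W^R(w,z₁)Y_V(u₁,z₂)⋯Y_V(u_{n-1},z_n)u_n` -/
  rationalityR : ∀ (n : ℕ) (w : W) (v : Fin (n+1) → V) (φ : W →ₗ[ℂ] ℂ),
    InGradedDual gr.proj φ → ∃ R : RatFn (Fin (n+1)),
      ∀ z : Fin (n+1) → ℂ, OrderedPos z →
        AbsConvTo (fun k : Fin (n+1) → ℤ =>
            φ (YR w (compApply n (fun i x => A.Y (v i.castSucc) x (k i.succ))
                (v (Fin.last n))) (k 0)) * ∏ i, z i ^ (-(k i) - 1))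
          (R.eval z)
  /-- rationality of iterates and associativity for the right vertex operator map -/
  associativityR : ∀ (w : W) (u₁ u₂ : V) (φ : W →ₗ[ℂ] ℂ), InGradedDual gr.proj φ →
    ∃ R : RatFn (Fin 2),
      (∀ z₁ z₂ : ℂ, ‖z₂‖ < ‖z₁‖ → 0 < ‖z₂‖ →
        AbsConvTo (fun k : ℤ × ℤ =>
            φ (YR w (A.Y u₁ u₂ k.2) k.1) * z₁ ^ (-k.1 - 1) * z₂ ^ (-k.2 - 1))
          (R.eval ![z₁, z₂])) ∧
      (∀ z₁ z₂ : ℂ, ‖z₁ - z₂‖ < ‖z₂‖ → 0 < ‖z₁ - z₂‖ →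
        AbsConvTo (fun k : ℤ × ℤ =>
            φ (YR (YR w u₁ k.1) u₂ k.2) * (z₁ - z₂) ^ (-k.1 - 1) * z₂ ^ (-k.2 - 1))
          (R.eval ![z₁, z₂]))
  /-- compatibility: rationality of mixed products
  `Y_W^L(u₁,z₁)⋯Y_W^L(u_p,z_p)Y_W^R(w,z₀)Y_V(v₁,⋅)⋯Y_V(v_{q},⋅)v_{q+1}` -/
  compatRat : ∀ (p q : ℕ) (u : Fin p → V) (w : W) (v : Fin (q+1) → V)
      (φ : W →ₗ[ℂ] ℂ), InGradedDual gr.proj φ →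
    ∃ R : RatFn (Fin p ⊕ Fin (q+1)),
      ∀ (zL : Fin p → ℂ) (z0 : ℂ) (zR : Fin q → ℂ),
        Ordered zL → (∀ i, ‖z0‖ < ‖zL i‖) → (∀ j, ‖zR j‖ < ‖z0‖) → Ordered zR →
        0 < ‖z0‖ → (∀ j, 0 < ‖zR j‖) →
        AbsConvTo (fun K : (Fin p → ℤ) × ℤ × (Fin q → ℤ) =>
            φ (compApply p (fun i x => YL (u i) x (K.1 i))
                (YR w (compApply q (fun j x => A.Y (v j.castSucc) x (K.2.2 j))
                  (v (Fin.last q))) K.2.1))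
              * (∏ i, zL i ^ (-(K.1 i) - 1)) * z0 ^ (-K.2.1 - 1)
              * ∏ j, zR j ^ (-(K.2.2 j) - 1))
          (R.eval (Sum.elim zL (Fin.cons z0 zR)))
  /-- compatibility: associativity for the left and right vertex operator maps -/
  compatAssoc : ∀ (u v : V) (w : W) (φ : W →ₗ[ℂ] ℂ), InGradedDual gr.proj φ →
    ∃ R : RatFn (Fin 2),
      (∀ z₁ z₂ : ℂ, ‖z₂‖ < ‖z₁‖ → 0 < ‖z₂‖ →
        AbsConvTo (fun k : ℤ × ℤ =>
            φ (YL u (YR w v k.2) k.1) * z₁ ^ (-k.1 - 1) * z₂ ^ (-k.2 - 1))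
          (R.eval ![z₁, z₂])) ∧
      (∀ z₁ z₂ : ℂ, ‖z₁ - z₂‖ < ‖z₂‖ → 0 < ‖z₁ - z₂‖ →
        AbsConvTo (fun k : ℤ × ℤ =>
            φ (YR (YL u w k.1) v k.2) * (z₁ - z₂) ^ (-k.1 - 1) * z₂ ^ (-k.2 - 1))
          (R.eval ![z₁, z₂]))

variable {W : Type*} [AddCommGroup W] [Module ℂ W] {A : MOSVA V}

/-- The opposite right vertex operator map
`Y_W^{s(R)}(v,x)w = e^{xD_W}Y_W^R(w,-x)v`, through its coefficients. -/
def Bimod.YsR (B : Bimod A W) (v : V) (w : W) (k : ℤ) : W :=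
  ∑ᶠ m : ℕ, (((-1 : ℂ) ^ (k + (m : ℤ) + 1)) * ((m.factorial : ℂ))⁻¹) •
    ((B.DW ^ m) (B.YR w v (k + (m : ℤ))))

/-- The pole-order condition for a bimodule over a MOSVA. -/
def Bimod.PoleOrder (B : Bimod A W) : Prop :=
  (∀ (u₁ : V) (w : W), ∃ C : ℕ, ∀ φ : W →ₗ[ℂ] ℂ, InGradedDual B.gr.proj φ → ∀ u₂ : V,
    ∃ R : RatFn (Fin 2), R.a 0 ≤ C ∧
      ∀ z₁ z₂ : ℂ, ‖z₂‖ < ‖z₁‖ → 0 < ‖z₂‖ →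
        AbsConvTo (fun k : ℤ × ℤ =>
            φ (B.YL u₁ (B.YL u₂ w k.2) k.1) * z₁ ^ (-k.1 - 1) * z₂ ^ (-k.2 - 1))
          (R.eval ![z₁, z₂])) ∧
  (∀ (u₂ : V) (w : W), ∃ C : ℕ, ∀ φ : W →ₗ[ℂ] ℂ, InGradedDual B.gr.proj φ → ∀ u₁ : V,
    ∃ R : RatFn (Fin 2), R.a 0 ≤ C ∧
      ∀ z₁ z₂ : ℂ, ‖z₂‖ < ‖z₁‖ → 0 < ‖z₂‖ →
        AbsConvTo (fun k : ℤ × ℤ =>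
            φ (B.YR w (A.Y u₁ u₂ k.2) k.1) * z₁ ^ (-k.1 - 1) * z₂ ^ (-k.2 - 1))
          (R.eval ![z₁, z₂])) ∧
  (∀ (u₁ u₂ : V), ∃ C : ℕ, ∀ φ : W →ₗ[ℂ] ℂ, InGradedDual B.gr.proj φ → ∀ w : W,
    ∃ R : RatFn (Fin 2), R.a 0 ≤ C ∧
      ∀ z₁ z₂ : ℂ, ‖z₂‖ < ‖z₁‖ → 0 < ‖z₂‖ →
        AbsConvTo (fun k : ℤ × ℤ =>
            φ (B.YL u₁ (B.YR w u₂ k.2) k.1) * z₁ ^ (-k.1 - 1) * z₂ ^ (-k.2 - 1))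
          (R.eval ![z₁, z₂]))

end VOA


section Cochains

variable {V : Type*} [AddCommGroup V] [Module ℂ V]
variable {W : Type*} [AddCommGroup W] [Module ℂ W] {A : MOSVA V}

/-- A `W̄`-valued rational function in the variables `z i`, `i : ι`, with the only
possible poles at `z i = z j`: a map from configuration space to the algebraic
completion whose pairings with graded-dual functionals are such rational functions,
with pole orders uniform in the functional, as witnessed by a formal power series
with coefficients in `W` (condition (ii)). -/
def CGrading.WTilde (G : CGrading W) {ι : Type*} [Fintype ι] [DecidableEq ι]
    (f : (ι → ℂ) → G.Comp) : Prop :=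
  (∀ φ : W →ₗ[ℂ] ℂ, InGradedDual G.proj φ →
      ∃ R : DiagRatFn ι, ∀ z : ι → ℂ, Conf z → G.pair φ (f z) = R.eval z) ∧
  ∃ (p : ι → ι → ℤ) (b : (ι → ℕ) → W),
    ∀ φ : W →ₗ[ℂ] ℂ, InGradedDual G.proj φ →
      (Function.support fun k => φ (b k)).Finite ∧
      ∀ z : ι → ℂ, Conf z →
        (∏ q ∈ Finset.univ.offDiag, (z q.1 - z q.2) ^ (p q.1 q.2)) * G.pair φ (f z)
          = ∑ᶠ k : ι → ℕ, φ (b k) * ∏ i, z i ^ (k i)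

/-- The pattern of left/right vertex operators: the `i`-th operator is
`Y_W^L(u i, z i)` if `isL i`, and `Y_W^{s(R)}(u i, z i)` otherwise; `k` records the
coefficient extracted from each operator. -/
def patOps (B : Bimod A W) {n : ℕ} (isL : Fin n → Bool) (u : Fin n → V)
    (k : Fin n → ℤ) : Fin n → (W → W) :=
  fun i => if isL i then fun x => B.YL (u i) x (k i) else fun x => B.YsR (u i) x (k i)

/-- The pattern with `l` left operators followed by `n - l` opposite right operators. -/
def prefixPat (n l : ℕ) : Fin n → Bool := fun i => decide ((i : ℕ) < l)

/-- A vector `w` such that `Y_W^L(u,x)w ∈ W[[x]]` and `Y_W^{s(R)}(u,x)w ∈ W[[x]]`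
for every `u ∈ V`. -/
def Bimod.RegVec (B : Bimod A W) (w : W) : Prop :=
  ∀ (u : V) (k : ℤ), 0 ≤ k → B.YL u w k = 0 ∧ B.YsR u w k = 0

/-- `f` represents the `W̄`-valued rational function
`E(Y^{L/sR}(u 0, z 0)⋯Y^{L/sR}(u (n-1), z (n-1)) w)` (with the operators prescribed
by the pattern `isL`): `f` is a `W̄`-valued rational function with only diagonal
poles whose pairings are the sums of the corresponding series of matrix coefficients
on the region `|z 0| > ⋯ > |z (n-1)| > 0`. -/
def RepEPat (B : Bimod A W) {n : ℕ} (isL : Fin n → Bool) (u : Fin n → V) (w : W)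
    (f : (Fin n → ℂ) → B.gr.Comp) : Prop :=
  B.gr.WTilde f ∧
  ∀ φ : W →ₗ[ℂ] ℂ, InGradedDual B.gr.proj φ → ∀ z : Fin n → ℂ, OrderedPos z →
    AbsConvTo (fun k : Fin n → ℤ =>
        φ (compApply n (patOps B isL u k) w) * ∏ i, z i ^ (-(k i) - 1))
      (B.gr.pair φ (f z))

/-- `f` represents the `W̄`-valued rational function given by a product of groups of
vertex operators, with group `i` of size `α i` and left/right pattern `isL`;
the variables are indexed by the sigma type `(i : Fin N) × Fin (α i)`. -/
def RepESig (B : Bimod A W) {N : ℕ} (α : Fin N → ℕ)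
    (isL : (i : Fin N) → Fin (α i) → Bool)
    (u : (i : Fin N) → Fin (α i) → V) (w : W)
    (f : (((i : Fin N) × Fin (α i)) → ℂ) → B.gr.Comp) : Prop :=
  B.gr.WTilde f ∧
  ∀ φ : W →ₗ[ℂ] ℂ, InGradedDual B.gr.proj φ →
    ∀ Z : (i : Fin N) → Fin (α i) → ℂ,
      (∀ (i : Fin N) (s t : Fin (α i)), s < t → ‖Z i t‖ < ‖Z i s‖) →
      (∀ (i j : Fin N), i < j → ∀ (s : Fin (α i)) (t : Fin (α j)), ‖Z j t‖ < ‖Z i s‖) →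
      (∀ (i : Fin N) (s : Fin (α i)), 0 < ‖Z i s‖) →
      AbsConvTo (fun K : (i : Fin N) → Fin (α i) → ℤ =>
          φ (compApply N (fun i x => compApply (α i) (fun s y =>
              if isL i s then B.YL (u i s) y (K i s) else B.YsR (u i s) y (K i s)) x) w)
            * ∏ i, ∏ s, Z i s ^ (-(K i s) - 1))
        (B.gr.pair φ (f (fun q => Z q.1 q.2)))

/-- Multilinearity of a map on `n`-tuples of vectors. -/
def IsMultilinear {M : Type*} [AddCommMonoid M] [Module ℂ M] {n : ℕ}
    (Φ : (Fin n → V) → M) : Prop :=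
  (∀ (v : Fin n → V) (i : Fin n) (x y : V),
      Φ (Function.update v i (x + y)) = Φ (Function.update v i x) + Φ (Function.update v i y)) ∧
  ∀ (v : Fin n → V) (i : Fin n) (c : ℂ) (x : V),
      Φ (Function.update v i (c • x)) = c • Φ (Function.update v i x)

/-- The `D`-derivative property of a map `Φ : V^{⊗n} → W̃_{z₁,…,zₙ}`. -/
def DDerivProp (A : MOSVA V) (B : Bimod A W) {n : ℕ}
    (Φ : (Fin n → V) → (Fin n → ℂ) → B.gr.Comp) : Prop :=
  (∀ (v : Fin n → V) (i : Fin n) (φ : W →ₗ[ℂ] ℂ), InGradedDual B.gr.proj φ →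
    ∀ z : Fin n → ℂ, Conf z →
      HasDerivAt (fun t : ℂ => B.gr.pair φ (Φ v (Function.update z i t)))
        (B.gr.pair φ (Φ (Function.update v i (A.D (v i))) z)) (z i)) ∧
  (∀ (v : Fin n → V) (φ : W →ₗ[ℂ] ℂ), InGradedDual B.gr.proj φ →
    ∀ z : Fin n → ℂ, Conf z →
      B.gr.pair φ (B.gr.ext (⇑B.DW) (Φ v z)) =
        ∑ i, B.gr.pair φ (Φ (Function.update v i (A.D (v i))) z))

/-- The `d`-conjugation property of a map `Φ : V^{⊗n} → W̃_{z₁,…,zₙ}`. -/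
def DConjProp (A : MOSVA V) (B : Bimod A W) {n : ℕ}
    (Φ : (Fin n → V) → (Fin n → ℂ) → B.gr.Comp) : Prop :=
  ∀ (v : Fin n → V) (φ : W →ₗ[ℂ] ℂ), InGradedDual B.gr.proj φ →
    ∀ (z : Fin n → ℂ) (c : ℂ), c ≠ 0 → Conf z → Conf (fun i => c * z i) →
      B.gr.pair φ (B.gr.zd c (Φ v z)) =
        B.gr.pair φ (Φ (fun i => A.gr.zd c (v i)) (fun i => c * z i))

/-- Composability of `Φ : V^{⊗n} → W̃` with `m` vertex operators. -/
def ComposableWith (A : MOSVA V) (B : Bimod A W) (n m : ℕ)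
    (Φ : (Fin n → V) → (Fin n → ℂ) → B.gr.Comp) : Prop :=
  ∃ Cb : V → V → ℕ,
  ∀ (α : Fin (n+1) → ℕ), (∑ i, α i) = m + n →
  ∀ l₀ : ℕ, l₀ ≤ α 0 →
  ∀ u : (i : Fin (n+1)) → Fin (α i) → V,
  ∀ φ : W →ₗ[ℂ] ℂ, InGradedDual B.gr.proj φ →
  ∃ R : DiagRatFn ((i : Fin (n+1)) × Fin (α i)),
    (∀ q q' : (i : Fin (n+1)) × Fin (α i), R.b q q' ≤ Cb (u q.1 q.2) (u q'.1 q'.2)) ∧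
    ∀ (z : (i : Fin (n+1)) → Fin (α i) → ℂ) (ζ : Fin n → ℂ),
      (∀ s t : Fin (α 0), s < t → ‖z 0 t‖ < ‖z 0 s‖) →
      (∀ (j : Fin (α 0)) (i : Fin n) (t : Fin (α i.succ)),
          ‖ζ i‖ + ‖z i.succ t - ζ i‖ < ‖z 0 j‖) →
      (∀ (i : Fin n) (s t : Fin (α i.succ)), s < t →
          ‖z i.succ t - ζ i‖ < ‖z i.succ s - ζ i‖) →
      (∀ (i j : Fin n), i < j → ∀ (s : Fin (α i.succ)) (t : Fin (α j.succ)),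
          ‖(z i.succ s - ζ i) - (z j.succ t - ζ j)‖ < ‖ζ i - ζ j‖) →
      AbsConvTo (fun K : (i : Fin (n+1)) → Fin (α i) → ℤ =>
          B.gr.pair φ
            (compApply (α 0) (fun j => B.gr.ext (fun x =>
                if (j : ℕ) < l₀ then B.YL (u 0 j) x (K 0 j) else B.YsR (u 0 j) x (K 0 j)))
              (Φ (fun i => compApply (α i.succ)
                    (fun s x => A.Y (u i.succ s) x (K i.succ s)) A.vac) ζ))
            * (∏ j, z 0 j ^ (-(K 0 j) - 1))
            * ∏ i : Fin n, ∏ s, (z i.succ s - ζ i) ^ (-(K i.succ s) - 1))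
        (R.eval (fun q => z q.1 q.2))

/-- The set `Ĉ^n_m(V,W)`: maps `V^{⊗n} → W̃_{z₁,…,zₙ}` that are linear, satisfy the
`D`-derivative and `d`-conjugation properties and are composable with `m` vertex
operators. -/
def IsCochain (A : MOSVA V) (B : Bimod A W) (n m : ℕ)
    (Φ : (Fin n → V) → (Fin n → ℂ) → B.gr.Comp) : Prop :=
  IsMultilinear Φ ∧ (∀ v, B.gr.WTilde (Φ v)) ∧ DDerivProp A B Φ ∧ DConjProp A B Φ ∧
    ComposableWith A B n m Φ

/-- `Ψ` represents `E_W^{(1,0)} ∘₂ Φ`, i.e. the map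
`v ↦ E(Y_W^L(v 0, z 0) Φ(v 1 ⊗ ⋯ ⊗ v n)(z 1,…,z n))`. -/
def RepLeft (A : MOSVA V) (B : Bimod A W) {n : ℕ}
    (Φ : (Fin n → V) → (Fin n → ℂ) → B.gr.Comp)
    (Ψ : (Fin (n+1) → V) → (Fin (n+1) → ℂ) → B.gr.Comp) : Prop :=
  (∀ v, B.gr.WTilde (Ψ v)) ∧
  ∀ (v : Fin (n+1) → V) (φ : W →ₗ[ℂ] ℂ), InGradedDual B.gr.proj φ →
    ∀ (z₀ : ℂ) (zt : Fin n → ℂ), Conf (Fin.cons z₀ zt) →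
      (∀ i, ‖zt i‖ < ‖z₀‖) → (∀ i, 0 < ‖zt i‖) →
      AbsConvTo (fun k : ℤ =>
          B.gr.pair φ (B.gr.ext (fun x => B.YL (v 0) x k) (Φ (Fin.tail v) zt))
            * z₀ ^ (-k - 1))
        (B.gr.pair φ (Ψ v (Fin.cons z₀ zt)))

/-- `Ψ` represents `E_W^{(0,1)} ∘₂ Φ`, i.e. the map
`v ↦ E(Y_W^{s(R)}(v (n+1), z (n+1)) Φ(v 1 ⊗ ⋯ ⊗ v n)(z 1,…,z n))`. -/
def RepRight (A : MOSVA V) (B : Bimod A W) {n : ℕ}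
    (Φ : (Fin n → V) → (Fin n → ℂ) → B.gr.Comp)
    (Ψ : (Fin (n+1) → V) → (Fin (n+1) → ℂ) → B.gr.Comp) : Prop :=
  (∀ v, B.gr.WTilde (Ψ v)) ∧
  ∀ (v : Fin (n+1) → V) (φ : W →ₗ[ℂ] ℂ), InGradedDual B.gr.proj φ →
    ∀ (zl : ℂ) (zi : Fin n → ℂ), Conf (Fin.snoc zi zl) →
      (∀ i, ‖zi i‖ < ‖zl‖) → (∀ i, 0 < ‖zi i‖) →
      AbsConvTo (fun k : ℤ =>
          B.gr.pair φ (B.gr.ext (fun x => B.YsR (v (Fin.last n)) x k) (Φ (Fin.init v) zi))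
            * zl ^ (-k - 1))
        (B.gr.pair φ (Ψ v (Fin.snoc zi zl)))

/-- Replace the two adjacent entries `i, i+1` of an `(n+1)`-tuple by a single entry. -/
def mergeAt {M : Type*} {n : ℕ} (i : Fin n) (v : Fin (n+1) → M) (a : M) : Fin n → M :=
  fun j => if j < i then v j.castSucc else if j = i then a else v j.succ

/-- `Ψ` represents `Φ ∘ᵢ E_V^{(2)}`, i.e. the map
`v ↦ E(Φ(v 1 ⊗ ⋯ ⊗ Y_V(v i, z i − ζ)Y_V(v (i+1), z (i+1) − ζ)𝟏 ⊗ ⋯ ⊗ v (n+1))(…,ζ,…))`. -/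
def RepCirc (A : MOSVA V) (B : Bimod A W) {n : ℕ} (i : Fin n)
    (Φ : (Fin n → V) → (Fin n → ℂ) → B.gr.Comp)
    (Ψ : (Fin (n+1) → V) → (Fin (n+1) → ℂ) → B.gr.Comp) : Prop :=
  (∀ v, B.gr.WTilde (Ψ v)) ∧
  ∀ (v : Fin (n+1) → V) (φ : W →ₗ[ℂ] ℂ), InGradedDual B.gr.proj φ →
    ∀ (z : Fin (n+1) → ℂ) (ζ : ℂ), Conf z → Conf (mergeAt i z ζ) →
      ‖z i.succ - ζ‖ < ‖z i.castSucc - ζ‖ → 0 < ‖z i.succ - ζ‖ →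
      (∀ j : Fin (n+1), j ≠ i.castSucc → j ≠ i.succ →
        ‖z i.castSucc - ζ‖ < ‖z j - z i.castSucc‖ ∧ ‖z i.succ - ζ‖ < ‖z j - z i.succ‖) →
      AbsConvTo (fun k : ℤ × ℤ =>
          B.gr.pair φ
            (Φ (mergeAt i v (A.Y (v i.castSucc) (A.Y (v i.succ) A.vac k.2) k.1))
              (mergeAt i z ζ))
            * (z i.castSucc - ζ) ^ (-k.1 - 1) * (z i.succ - ζ) ^ (-k.2 - 1))
        (B.gr.pair φ (Ψ v z))

/-- `Ψ` represents the coboundary `δ̂Φ = E_W^{(1,0)}∘₂Φ + Σᵢ (−1)^i Φ∘ᵢE_V^{(2)}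
+ (−1)^{n+1} E_W^{(0,1)}∘₂Φ` of the `n`-cochain `Φ`. -/
def IsDelta (A : MOSVA V) (B : Bimod A W) {n : ℕ}
    (Φ : (Fin n → V) → (Fin n → ℂ) → B.gr.Comp)
    (Ψ : (Fin (n+1) → V) → (Fin (n+1) → ℂ) → B.gr.Comp) : Prop :=
  ∃ (gL gR : (Fin (n+1) → V) → (Fin (n+1) → ℂ) → B.gr.Comp)
    (gC : Fin n → (Fin (n+1) → V) → (Fin (n+1) → ℂ) → B.gr.Comp),
    RepLeft A B Φ gL ∧ RepRight A B Φ gR ∧ (∀ i, RepCirc A B i Φ (gC i)) ∧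
    ∀ v z, Ψ v z = gL v z + (∑ i : Fin n, ((-1 : ℂ) ^ ((i : ℕ) + 1)) • gC i v z)
      + ((-1 : ℂ) ^ (n + 1)) • gR v z

end Cochains


/-! ### Laurent series on polyannuli -/

section Laurent

variable {ι : Type*} [Fintype ι]

theorem AbsConvTo.of_hasSum {α : Type*} {f : α → ℂ} {s : ℂ} (h : HasSum f s) : AbsConvTo f s :=
  ⟨h.summable.norm, h⟩

/-- The Laurent monomial `∏ i, z i ^ (-(k i) - 1)`. -/
def mon (z : ι → ℂ) (k : ι → ℤ) : ℂ := ∏ i, z i ^ (-(k i) - 1)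

theorem mon_ne_zero {z : ι → ℂ} (hz : ∀ i, z i ≠ 0) (k : ι → ℤ) : mon z k ≠ 0 :=
  Finset.prod_ne_zero_iff.2 fun i _ => zpow_ne_zero _ (hz i)

/-- A Laurent series vanishing on a torus has vanishing coefficients. -/
theorem laurent_unique (r : ι → ℝ) (hr : ∀ i, 0 < r i) (d : (ι → ℤ) → ℂ)
    (h : ∀ z : ι → ℂ, (∀ i, ‖z i‖ = r i) → HasSum (fun k => d k * mon z k) 0) : d = 0 := by
  classical
  set ρ : ι → ℂ := fun i => (r i : ℂ)
  have hρ0 : ∀ i, ρ i ≠ 0 := fun i => by simpa [ρ] using (hr i).ne'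
  have hρ : ∀ i, ‖ρ i‖ = r i := fun i => by simp [ρ, abs_of_pos (hr i)]
  set c : (ι → ℤ) → ℂ := fun k => d k * mon ρ k
  have hc : Summable fun k => ‖c k‖ := (h ρ hρ).summable.norm
  set F : (ι → ℤ) → C(UnitAddTorus ι, ℂ) := fun k => c k • UnitAddTorus.mFourier (-k - 1)
  have hF : Summable F := by
    refine Summable.of_norm (hc.congr fun k => ?_)
    simp [F, norm_smul, UnitAddTorus.mFourier_norm]
  have hF0 : HasSum F 0 := by
    obtain ⟨g, hg⟩ := hF
    have : g = 0 := by
      ext x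
      have h1 : HasSum (fun k => F k x) (g x) := (ContinuousMap.hasSum_apply hg x)
      have h2 := h (fun i => ρ i * fourier 1 (x i)) (fun i => by
        rw [norm_mul, hρ, fourier_apply, Circle.norm_coe, mul_one])
      have h3 : g x = 0 := by
        refine h1.unique ?_
        convert h2 using 2 with k
        simp only [F, c, mon, ContinuousMap.smul_apply, UnitAddTorus.mFourier, smul_eq_mul,
          ContinuousMap.coe_mk, mul_zpow, Finset.prod_mul_distrib, mul_assoc]
        congr 2
        refine Finset.prod_congr rfl fun i _ => ?_
        simp only [fourier_apply, Pi.sub_apply, Pi.neg_apply, Pi.one_apply, one_smul,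
          AddCircle.toCircle_zsmul, Circle.coe_zpow]
      rw [h3]
      rfl
    rwa [this] at hg
  have key : ∀ T : C(UnitAddTorus ι, ℂ) →L[ℂ] _,
      (∀ k, T (UnitAddTorus.mFourier k) = UnitAddTorus.mFourierLp (d := ι) 2 k) →
      HasSum (fun k => c k • UnitAddTorus.mFourierLp (d := ι) 2 (-k - 1)) 0 := by
    intro T hT
    have := hF0.mapL T
    simp only [F, map_smul, map_zero, hT] at this
    exact this
  have h3 := by
    letI : MeasureTheory.MeasureSpace UnitAddCircle := ⟨AddCircle.haarAddCircle⟩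
    haveI : MeasureTheory.IsProbabilityMeasure
        (MeasureTheory.volume : MeasureTheory.Measure UnitAddCircle) :=
      inferInstanceAs (MeasureTheory.IsProbabilityMeasure AddCircle.haarAddCircle)
    exact key (ContinuousMap.toLp (E := ℂ) 2 MeasureTheory.volume ℂ) fun k => rfl
  funext j
  have h4 := h3.mapL (innerSL ℂ (UnitAddTorus.mFourierLp (d := ι) 2 (-j - 1)))
  simp only [map_smul, map_zero, innerSL_apply_apply, smul_eq_mul,
    orthonormal_iff_ite.1 UnitAddTorus.orthonormal_mFourier] at h4
  have h5 : HasSum (fun k => c k * if -j - 1 = -k - 1 then (1 : ℂ) else 0) (c j) := by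
    convert hasSum_single j (f := fun k => c k * if -j - 1 = -k - 1 then (1 : ℂ) else 0) ?_ using 1
    · simp
    · intro k hk
      have : ¬ (-j - 1 = -k - 1) := by
        intro h
        apply hk
        simpa using h.symm
      simp [this]
  have h6 : d j * mon ρ j = 0 := h5.unique h4
  simpa using (mul_eq_zero.1 h6).resolve_right (mon_ne_zero hρ0 j)

theorem laurent_unique_one (r : ℝ) (hr : 0 < r) (d : ℤ → ℂ)
    (h : ∀ z : ℂ, ‖z‖ = r → HasSum (fun k => d k * z ^ (-k - 1)) 0) : d = 0 := by
  have := laurent_unique (ι := Unit) (fun _ => r) (fun _ => hr) (fun k => d (k ())) (fun z hz => by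
    have h1 := h (z ()) (hz ())
    rw [← (Equiv.funUnique Unit ℤ).hasSum_iff] at h1
    simpa [mon, Function.comp_def] using h1)
  funext k
  exact congrFun this (fun _ => k)

/-- `F` has a Laurent expansion which converges to it on `Ω`. -/
def Expandable (Ω : Set (ι → ℂ)) (F : (ι → ℂ) → ℂ) : Prop :=
  ∃ f : (ι → ℤ) → ℂ, ∀ z ∈ Ω, HasSum (fun k => f k * mon z k) (F z)

theorem Expandable.of_series {Ω : Set (ι → ℂ)} {F : (ι → ℂ) → ℂ}
    {J : Type*} (c : J → ℂ) (e : J → ι → ℤ)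
    (h : ∀ z ∈ Ω, HasSum (fun j => c j * mon z (e j)) (F z)) : Expandable Ω F := by
  refine ⟨fun k => ∑' j : {j // e j = k}, c j, fun z hz => ?_⟩
  have h1 := h z hz
  rw [← (Equiv.sigmaFiberEquiv e).hasSum_iff] at h1
  have h2 := h1.sigma (g := fun k => (∑' j : {j // e j = k}, c j) * mon z k) (fun k => by
    have h3 : Summable fun j : {j // e j = k} => c j * mon z k := by
      refine (h1.summable.sigma_factor k).congr fun j => ?_
      have := j.2
      simp [Equiv.sigmaFiberEquiv, this]
    have h4 := h3.hasSum
    rw [tsum_mul_right] at h4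
    convert h4 using 2 with j
    have := j.2
    simp [Equiv.sigmaFiberEquiv, this])
  exact h2

variable {Ω : Set (ι → ℂ)} {F G : (ι → ℂ) → ℂ}

theorem Expandable.congr (hF : Expandable Ω F) (h : ∀ z ∈ Ω, F z = G z) : Expandable Ω G := by
  obtain ⟨f, hf⟩ := hF
  exact ⟨f, fun z hz => h z hz ▸ hf z hz⟩

theorem Expandable.add (hF : Expandable Ω F) (hG : Expandable Ω G) :
    Expandable Ω (fun z => F z + G z) := by
  obtain ⟨f, hf⟩ := hF
  obtain ⟨g, hg⟩ := hG
  exact ⟨fun k => f k + g k, fun z hz => by simpa only [add_mul] using (hf z hz).add (hg z hz)⟩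

theorem Expandable.mul (hΩ : ∀ z ∈ Ω, ∀ i, z i ≠ 0) (hF : Expandable Ω F)
    (hG : Expandable Ω G) : Expandable Ω (fun z => F z * G z) := by
  obtain ⟨f, hf⟩ := hF
  obtain ⟨g, hg⟩ := hG
  refine .of_series (J := (ι → ℤ) × (ι → ℤ)) (fun p => f p.1 * g p.2)
    (fun p i => p.1 i + p.2 i + 1) fun z hz => ?_
  have hs := summable_mul_of_summable_norm (hf z hz).summable.norm (hg z hz).summable.norm
  have hp : ∀ k l : ι → ℤ, mon z (fun i => k i + l i + 1) = mon z k * mon z l := by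
    intro k l
    rw [mon, mon, mon, ← Finset.prod_mul_distrib]
    refine Finset.prod_congr rfl fun i _ => ?_
    rw [← zpow_add₀ (hΩ z hz i)]
    congr 1
    ring
  have := (hf z hz).mul (hg z hz) hs
  refine this.congr_fun fun p => ?_
  rw [hp]
  ring

theorem Expandable.monomial (c : ℂ) (e : ι → ℤ) :
    Expandable Ω (fun z => c * ∏ i, z i ^ e i) := by
  refine .of_series (fun _ : Unit => c) (fun _ i => -(e i) - 1) fun z hz => ?_
  convert hasSum_unique (fun _ : Unit => c * mon z fun i => -(e i) - 1) using 2
  simp [mon]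

theorem Expandable.const (c : ℂ) : Expandable Ω (fun _ => c) :=
  (Expandable.monomial c 0).congr (by simp)

theorem Expandable.coord_zpow [DecidableEq ι] (i : ι) (n : ℤ) :
    Expandable Ω (fun z => z i ^ n) :=
  (Expandable.monomial 1 (Pi.single i n)).congr fun z _ => by
    rw [one_mul, Finset.prod_eq_single i] <;> simp +contextual

theorem Expandable.coord [DecidableEq ι] (i : ι) :
    Expandable Ω (fun z => z i) := by
  simpa using Expandable.coord_zpow i 1

theorem Expandable.neg (hΩ : ∀ z ∈ Ω, ∀ i, z i ≠ 0) (hF : Expandable Ω F) :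
    Expandable Ω (fun z => - F z) := by
  simpa using (Expandable.const (-1)).mul hΩ hF

theorem Expandable.pow (hΩ : ∀ z ∈ Ω, ∀ i, z i ≠ 0) (hF : Expandable Ω F) (n : ℕ) :
    Expandable Ω (fun z => F z ^ n) := by
  induction n with
  | zero => simpa using Expandable.const 1
  | succ n ih => simpa only [pow_succ] using ih.mul hΩ hF

theorem Expandable.prod (hΩ : ∀ z ∈ Ω, ∀ i, z i ≠ 0) {α : Type*} (s : Finset α)
    {H : α → (ι → ℂ) → ℂ} (h : ∀ a ∈ s, Expandable Ω (H a)) :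
    Expandable Ω (fun z => ∏ a ∈ s, H a z) := by
  classical
  induction s using Finset.induction_on with
  | empty => simpa using Expandable.const 1
  | insert a s ha ih =>
    simp only [Finset.prod_insert ha]
    exact (h a (by simp)).mul hΩ (ih fun b hb => h b (by simp [hb]))

theorem hasSum_inv_one_sub_add {x y : ℂ} (h : ‖x‖ + ‖y‖ < 1) :
    HasSum (fun p : ℕ × ℕ => ((p.1 + p.2).choose p.1 : ℂ) * x ^ p.1 * y ^ p.2)
      (1 - (x + y))⁻¹ := by
  have key : ∀ a b : ℂ, ∀ n : ℕ, ∑ p ∈ Finset.HasAntidiagonal.antidiagonal n,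
      ((p.1 + p.2).choose p.1 : ℂ) * a ^ p.1 * b ^ p.2 = (a + b) ^ n := by
    intro a b n
    rw [(Commute.all a b).add_pow']
    refine Finset.sum_congr rfl fun p hp => ?_
    rw [Finset.HasAntidiagonal.mem_antidiagonal.1 hp, nsmul_eq_mul, mul_assoc]
  have hs : Summable (fun p : ℕ × ℕ => ((p.1 + p.2).choose p.1 : ℂ) * x ^ p.1 * y ^ p.2) := by
    refine Summable.of_norm ?_
    rw [← Finset.HasAntidiagonal.sigmaAntidiagonalEquivProd.summable_iff, summable_sigma_of_nonneg]
    · refine ⟨fun n => (hasSum_fintype _).summable, ?_⟩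
      have : Summable fun n : ℕ => (‖x‖ + ‖y‖) ^ n :=
        summable_geometric_of_lt_one (by positivity) h
      refine this.congr fun n => ?_
      have := key (‖x‖ : ℂ) (‖y‖ : ℂ) n
      rw [tsum_fintype, Finset.univ_eq_attach]
      simp only [Function.comp_apply, Finset.HasAntidiagonal.sigmaAntidiagonalEquivProd_apply]
      rw [Finset.sum_attach (Finset.HasAntidiagonal.antidiagonal n) (fun p : ℕ × ℕ =>
        ‖((p.1 + p.2).choose p.1 : ℂ) * x ^ p.1 * y ^ p.2‖)]
      simp only [norm_mul, norm_pow, Complex.norm_natCast]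
      exact_mod_cast this.symm
    · intro p
      exact norm_nonneg _
  have h1 := hs.hasSum
  rw [← Finset.HasAntidiagonal.sigmaAntidiagonalEquivProd.hasSum_iff] at h1
  have h2 := h1.sigma (g := fun n => (x + y) ^ n) (fun n => by
    rw [← key x y n, ← Finset.sum_attach]
    exact hasSum_fintype _)
  have h3 : HasSum (fun n => (x + y) ^ n) (1 - (x + y))⁻¹ :=
    hasSum_geometric_of_norm_lt_one ((norm_add_le x y).trans_lt h)
  rw [← h2.unique h3]
  exact hs.hasSum

/-- The inverse of a linear form is expandable where one of its terms dominates the others. -/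
theorem Expandable.inv_linear [DecidableEq ι] (hΩ : ∀ z ∈ Ω, ∀ i, z i ≠ 0) (d i j : ι) (α β : ℂ)
    (h : ∀ z ∈ Ω, ‖α * z i‖ + ‖β * z j‖ < ‖z d‖) :
    Expandable Ω (fun z => (z d - (α * z i + β * z j))⁻¹) := by
  refine .of_series (fun p : ℕ × ℕ => ((p.1 + p.2).choose p.1 : ℂ) * α ^ p.1 * β ^ p.2)
    (fun p q => -((if q = i then (p.1 : ℤ) else 0) + (if q = j then (p.2 : ℤ) else 0)
      + if q = d then (-p.1 - p.2 - 1 : ℤ) else 0) - 1) fun z hz => ?_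
  have hd := hΩ z hz d
  have hd' : 0 < ‖z d‖ := norm_pos_iff.2 hd
  have h1 := hasSum_inv_one_sub_add (x := α * z i / z d) (y := β * z j / z d) (by
    rw [norm_div, norm_div, ← add_div, div_lt_one hd']
    exact h z hz)
  have h2 := h1.mul_left (z d)⁻¹
  have e0 : (z d)⁻¹ * (1 - (α * z i / z d + β * z j / z d))⁻¹ = (z d - (α * z i + β * z j))⁻¹ := by
    rw [← mul_inv]
    congr 1
    field_simp
  rw [e0] at h2
  refine h2.congr_fun fun p => ?_
  · have : mon z (fun q => -((if q = i then (p.1 : ℤ) else 0) + (if q = j then (p.2 : ℤ) else 0)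
      + if q = d then (-p.1 - p.2 - 1 : ℤ) else 0) - 1)
      = z i ^ p.1 * z j ^ p.2 * z d ^ (-p.1 - p.2 - 1 : ℤ) := by
      simp only [mon]
      have : ∀ q, z q ^ (-(-((if q = i then (p.1 : ℤ) else 0) + (if q = j then (p.2 : ℤ) else 0)
      + if q = d then (-p.1 - p.2 - 1 : ℤ) else 0) - 1) - 1)
        = (if q = i then z i ^ p.1 else 1) * (if q = j then z j ^ p.2 else 1)
          * (if q = d then z d ^ (-p.1 - p.2 - 1 : ℤ) else 1) := by
        intro q
        have e : ∀ x : ℤ, -(-x - 1) - 1 = x := fun x => by ring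
        rw [e, zpow_add₀ (hΩ z hz q), zpow_add₀ (hΩ z hz q)]
        congr 1
        · congr 1
          · split_ifs with hq
            · simp [hq]
            · simp
          · split_ifs with hq
            · simp [hq]
            · simp
        · split_ifs with hq
          · simp [hq]
          · simp
      simp only [this, Finset.prod_mul_distrib, Finset.prod_ite_eq', Finset.mem_univ, if_true]
    rw [this]
    have e : z d ^ (-p.1 - p.2 - 1 : ℤ) = (z d)⁻¹ * ((z d ^ p.1)⁻¹ * (z d ^ p.2)⁻¹) := by
      rw [sub_eq_add_neg, sub_eq_add_neg, zpow_add₀ hd, zpow_add₀ hd]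
      simp only [zpow_neg, zpow_natCast, zpow_one]
      ring
    rw [e, div_pow, div_pow, mul_pow, mul_pow]
    simp only [div_eq_mul_inv]
    ring

end Laurent

/-! ### Expansions of rational functions with a block of iterated variables -/

section Expansion

variable {n : ℕ}

/-- The indices in the block of length `q` following `p`. -/
def InBlock (p : Fin n) (q : ℕ) (i : Fin n) : Prop := p < i ∧ (i : ℕ) ≤ p + q

/-- The change of variables shifting the block of length `q` following `p` by the variable `p`. -/
def shiftBlock (p : Fin n) (q : ℕ) (ζ : Fin n → ℂ) (i : Fin n) : ℂ :=
  open Classical in if InBlock p q i then ζ p + ζ i else ζ i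

theorem shiftBlock_of_mem {p : Fin n} {q : ℕ} {i : Fin n} (h : InBlock p q i) (ζ : Fin n → ℂ) :
    shiftBlock p q ζ i = ζ p + ζ i := if_pos h

theorem shiftBlock_of_notMem {p : Fin n} {q : ℕ} {i : Fin n} (h : ¬ InBlock p q i)
    (ζ : Fin n → ℂ) : shiftBlock p q ζ i = ζ i := if_neg h

/-- The region of convergence of the series with an iterated block of length `q` following `p`. -/
structure BlockRegion (p : Fin n) (q : ℕ) (ζ : Fin n → ℂ) : Prop where
  ne_zero : ∀ i, ζ i ≠ 0
  left : ∀ i j, i < j → j ≤ p → ‖ζ j‖ < ‖ζ i‖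
  left_block : ∀ i j, i < p → InBlock p q j → ‖ζ p‖ + ‖ζ j‖ < ‖ζ i‖
  left_right : ∀ i j : Fin n, i ≤ p → (p + q : ℕ) < j → ‖ζ j‖ < ‖ζ i‖
  block : ∀ i, InBlock p q i → ‖ζ i‖ < ‖ζ p‖
  block_right : ∀ i j : Fin n, InBlock p q i → (p + q : ℕ) < j → ‖ζ i‖ + ‖ζ j‖ < ‖ζ p‖
  block_block : ∀ i j, InBlock p q i → InBlock p q j → i < j → ‖ζ i‖ < ‖ζ j‖
  right : ∀ i j : Fin n, (p + q : ℕ) < i → i < j → ‖ζ j‖ < ‖ζ i‖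

theorem BlockRegion.of_orderedPos (p : Fin n) {ζ : Fin n → ℂ} (h : OrderedPos ζ) :
    BlockRegion p 0 ζ := by
  have hB : ∀ i, ¬ InBlock p 0 i := fun i hi => by
    have h1 := hi.1
    have h2 := hi.2
    rw [Fin.lt_def] at h1
    omega
  refine ⟨fun i => norm_pos_iff.1 (h.2 i), fun i j hij _ => h.1 i j hij,
    fun i j _ hj => (hB j hj).elim, fun i j hi hj => h.1 i j ?_, fun i hi => (hB i hi).elim,
    fun i j hi => (hB i hi).elim, fun i j hi => (hB i hi).elim, fun i j _ hij => h.1 i j hij⟩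
  rw [Fin.lt_def]
  rw [Fin.le_def] at hi
  omega

theorem shiftBlock_zero (p : Fin n) (ζ : Fin n → ℂ) : shiftBlock p 0 ζ = ζ := by
  funext i
  refine shiftBlock_of_notMem (fun hi => ?_) ζ
  have h1 := hi.1
  have h2 := hi.2
  rw [Fin.lt_def] at h1
  omega

variable (p : Fin n) (q : ℕ)

theorem expandable_inv_shiftBlock (i : Fin n) :
    Expandable {ζ | BlockRegion p q ζ} (fun ζ => (shiftBlock p q ζ i)⁻¹) := by
  by_cases hi : InBlock p q i
  · refine (Expandable.inv_linear (fun z hz => hz.ne_zero) p i i (-1) 0 fun z hz => ?_).congr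
      fun z hz => ?_
    · simpa using hz.block i hi
    · rw [shiftBlock_of_mem hi]
      ring
  · refine (Expandable.coord_zpow i (-1)).congr fun z hz => ?_
    rw [shiftBlock_of_notMem hi, zpow_neg_one]

theorem expandable_inv_shiftBlock_sub_of_lt {i j : Fin n} (hij : i < j) :
    Expandable {ζ | BlockRegion p q ζ}
      (fun ζ => (shiftBlock p q ζ i - shiftBlock p q ζ j)⁻¹) := by
  have h0 : ∀ z ∈ {ζ | BlockRegion p q ζ}, ∀ i, z i ≠ 0 := fun z hz => hz.ne_zero
  by_cases hi : InBlock p q i <;> by_cases hj : InBlock p q j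
  · refine ((Expandable.inv_linear h0 j i i 1 0 fun z hz => ?_).neg h0).congr fun z hz => ?_
    · simpa using hz.block_block i j hi hj hij
    · rw [shiftBlock_of_mem hi, shiftBlock_of_mem hj, ← inv_neg]
      congr 1
      ring
  · refine (Expandable.inv_linear h0 p i j (-1) 1 fun z hz => ?_).congr fun z hz => ?_
    · have : (p + q : ℕ) < j := by
        by_contra h
        exact hj ⟨hi.1.trans hij, by omega⟩
      simpa using hz.block_right i j hi this
    · rw [shiftBlock_of_mem hi, shiftBlock_of_notMem hj]
      congr 1
      ring
  · have hip : i ≤ p := by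
      by_contra h
      have h1 := hj.2
      rw [Fin.lt_def] at hij
      exact hi ⟨not_le.1 h, by omega⟩
    rcases hip.eq_or_lt with rfl | hip
    · refine ((Expandable.coord_zpow j (-1)).neg h0).congr fun z hz => ?_
      rw [shiftBlock_of_notMem hi, shiftBlock_of_mem hj, zpow_neg_one, ← inv_neg]
      congr 1
      ring
    · refine (Expandable.inv_linear h0 i p j 1 1 fun z hz => ?_).congr fun z hz => ?_
      · simpa using hz.left_block i j hip hj
      · rw [shiftBlock_of_notMem hi, shiftBlock_of_mem hj]
        congr 1
        ring
  · refine (Expandable.inv_linear h0 i j j 1 0 fun z hz => ?_).congr fun z hz => ?_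
    · suffices ‖z j‖ < ‖z i‖ by simpa using this
      rcases le_or_gt j p with hjp | hjp
      · exact hz.left i j hij hjp
      · have hj' : (p + q : ℕ) < j := by
          by_contra h
          exact hj ⟨hjp, by omega⟩
        rcases le_or_gt i p with hip | hip
        · exact hz.left_right i j hip hj'
        · refine hz.right i j ?_ hij
          by_contra h
          exact hi ⟨hip, by omega⟩
    · rw [shiftBlock_of_notMem hi, shiftBlock_of_notMem hj]
      congr 1
      ring

theorem expandable_inv_shiftBlock_sub {i j : Fin n} (hij : i ≠ j) :
    Expandable {ζ | BlockRegion p q ζ}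
      (fun ζ => (shiftBlock p q ζ i - shiftBlock p q ζ j)⁻¹) := by
  rcases hij.lt_or_gt with h | h
  · exact expandable_inv_shiftBlock_sub_of_lt p q h
  · refine ((expandable_inv_shiftBlock_sub_of_lt p q h).neg fun z hz => hz.ne_zero).congr
      fun z _ => ?_
    rw [← inv_neg, neg_sub]

theorem expandable_shiftBlock (i : Fin n) :
    Expandable {ζ | BlockRegion p q ζ} (fun ζ => shiftBlock p q ζ i) := by
  by_cases hi : InBlock p q i
  · simp only [shiftBlock_of_mem hi]
    exact (Expandable.coord p).add (Expandable.coord i)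
  · simp only [shiftBlock_of_notMem hi]
    exact Expandable.coord i

theorem expandable_ratFn (R : RatFn (Fin n)) :
    Expandable {ζ | BlockRegion p q ζ} (fun ζ => R.eval (shiftBlock p q ζ)) := by
  have h0 : ∀ z ∈ {ζ | BlockRegion p q ζ}, ∀ i, z i ≠ 0 := fun z hz => hz.ne_zero
  have hnum : Expandable {ζ | BlockRegion p q ζ}
      (fun ζ => MvPolynomial.eval (shiftBlock p q ζ) R.num) := by
    induction R.num using MvPolynomial.induction_on with
    | C a => simpa using Expandable.const a
    | add f g hf hg => simpa using hf.add hg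
    | mul_X f i hf => simpa using hf.mul h0 (expandable_shiftBlock p q i)
  have ha := Expandable.prod h0 Finset.univ fun i _ =>
    (expandable_inv_shiftBlock p q i).pow h0 (R.a i)
  have hb := Expandable.prod h0 (Finset.univ.offDiag : Finset (Fin n × Fin n)) fun i hi =>
    (expandable_inv_shiftBlock_sub p q (Finset.mem_offDiag.1 hi).2.2).pow h0 (R.b i.1 i.2)
  refine (hnum.mul h0 (ha.mul h0 hb)).congr fun z _ => ?_
  simp only [RatFn.eval, inv_pow, Finset.prod_inv_distrib, div_eq_mul_inv, mul_inv]

end Expansion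

/-! ### Binomial expansions -/

section Binomial

/-- The coefficient of `x ^ p` in `(1 - x) ^ (-k - 1)`. -/
def bc (k : ℤ) (p : ℕ) : ℂ := ∏ j ∈ Finset.range p, ((k : ℂ) + 1 + j) / (j + 1)

@[simp]
theorem bc_zero (k : ℤ) : bc k 0 = 1 := by simp [bc]

theorem bc_succ (k : ℤ) (p : ℕ) : bc k (p + 1) = bc k p * (((k : ℂ) + 1 + p) / (p + 1)) :=
  Finset.prod_range_succ _ _

theorem bc_succ_mul (k : ℤ) (p : ℕ) :
    bc k (p + 1) * ((p : ℂ) + 1) = bc (k + 1) p * ((k : ℂ) + 1) := by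
  induction p with
  | zero => simp [bc_succ]
  | succ p ih =>
    have h0 : (p : ℂ) + 1 ≠ 0 := Nat.cast_add_one_ne_zero p
    have h1 : (p : ℂ) + 1 + 1 ≠ 0 := by exact_mod_cast Nat.cast_add_one_ne_zero (R := ℂ) (p + 1)
    rw [bc_succ k (p + 1), bc_succ (k + 1) p]
    push_cast
    rw [← mul_right_inj' h0]
    field_simp
    linear_combination ((k : ℂ) + 1 + p + 1) * ih

theorem bc_eq_choose (k : ℤ) (p : ℕ) : bc k p = Ring.choose ((k : ℂ) + 1 + p - 1) p := by
  have h1 : (p.factorial : ℂ) * Ring.choose ((k : ℂ) + 1 + p - 1) p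
      = (ascPochhammer ℂ p).eval ((k : ℂ) + 1) := by
    rw [Ring.choose, ← nsmul_eq_mul, Ring.factorial_nsmul_multichoose_eq_ascPochhammer,
      Polynomial.ascPochhammer_smeval_eq_eval]
    congr 1
    ring
  have h2 : ∀ q : ℕ, (q.factorial : ℂ) * bc k q = (ascPochhammer ℂ q).eval ((k : ℂ) + 1) := by
    intro q
    induction q with
    | zero => simp
    | succ q ih =>
      rw [ascPochhammer_succ_eval, ← ih, bc_succ, Nat.factorial_succ]
      have : (q : ℂ) + 1 ≠ 0 := Nat.cast_add_one_ne_zero q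
      push_cast
      field_simp
  exact mul_left_cancel₀ (Nat.cast_ne_zero.2 p.factorial_ne_zero) ((h2 p).trans h1.symm)

theorem hasSum_bc (k : ℤ) {x : ℂ} (hx : ‖x‖ < 1) :
    HasSum (fun p : ℕ => bc k p * x ^ p) ((1 - x) ^ (-k - 1)) := by
  have h := (Complex.one_div_one_sub_cpow_hasFPowerSeriesOnBall_zero ((k : ℂ) + 1)).hasSum
    (y := x) (by simpa [enorm_eq_nnnorm, ← NNReal.coe_lt_coe] using hx)
  have e : 1 / (1 - (0 + x)) ^ ((k : ℂ) + 1) = (1 - x) ^ (-k - 1) := by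
    have : ((k : ℂ) + 1) = ((k + 1 : ℤ) : ℂ) := by push_cast; ring
    rw [this, Complex.cpow_intCast, zero_add, one_div, ← zpow_neg]
    congr 1
    ring
  rw [e] at h
  refine h.congr_fun fun p => ?_
  rw [FormalMultilinearSeries.ofScalars_apply_eq, bc_eq_choose, smul_eq_mul]

theorem norm_bc (k : ℤ) :
    (∀ p, (‖bc k p‖ : ℂ) = bc k p) ∨ ∀ p, (‖bc k p‖ : ℂ) = (-1) ^ p * bc k p := by
  rcases le_or_gt 0 k with hk | hk
  · left
    intro p
    have : bc k p = ((∏ j ∈ Finset.range p, ((k : ℝ) + 1 + j) / (j + 1) : ℝ) : ℂ) := by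
      simp [bc]
    rw [this, Complex.norm_real, Real.norm_of_nonneg]
    refine Finset.prod_nonneg fun j _ => ?_
    have : (0 : ℝ) ≤ k := by exact_mod_cast hk
    positivity
  · right
    obtain ⟨N, rfl⟩ : ∃ N : ℕ, k = -N - 1 := ⟨(-k - 1).toNat, by omega⟩
    intro p
    have h1 : (-1) ^ p * bc (-N - 1) p
        = ((∏ j ∈ Finset.range p, ((N : ℝ) - j) / (j + 1) : ℝ) : ℂ) := by
      simp only [bc]
      rw [← Finset.card_range p, ← Finset.prod_const, Finset.card_range, ← Finset.prod_mul_distrib]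
      push_cast
      refine Finset.prod_congr rfl fun j _ => ?_
      ring
    have h2 : 0 ≤ ∏ j ∈ Finset.range p, ((N : ℝ) - j) / (j + 1) := by
      rcases le_or_gt p N with h | h
      · refine Finset.prod_nonneg fun j hj => div_nonneg ?_ (by positivity)
        have : (j : ℝ) ≤ N := by exact_mod_cast (Finset.mem_range.1 hj).le.trans h
        linarith
      · rw [Finset.prod_eq_zero (Finset.mem_range.2 h)]
        simp
    have h3 : ‖bc (-N - 1) p‖ = ‖(-1 : ℂ) ^ p * bc (-N - 1) p‖ := by simp
    rw [h3, h1, Complex.norm_real, Real.norm_of_nonneg h2]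

theorem hasSum_norm_bc (k : ℤ) {r : ℝ} (h0 : 0 ≤ r) (h1 : r < 1) :
    ∃ s ≤ (1 - r) ^ (-k - 1) + (1 + r) ^ (-k - 1), HasSum (fun p : ℕ => ‖bc k p‖ * r ^ p) s := by
  have a1 : 0 < (1 - r) ^ (-k - 1) := zpow_pos (by linarith) _
  have a2 : 0 < (1 + r) ^ (-k - 1) := zpow_pos (by linarith) _
  rcases norm_bc k with h | h
  · refine ⟨(1 - r) ^ (-k - 1), by linarith, ?_⟩
    have := hasSum_bc k (x := (r : ℂ)) (by simpa [abs_of_nonneg h0] using h1)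
    rw [← Complex.hasSum_ofReal]
    push_cast
    exact this.congr_fun fun p => by rw [h]
  · refine ⟨(1 + r) ^ (-k - 1), by linarith, ?_⟩
    have := hasSum_bc k (x := (-r : ℂ)) (by simpa [abs_of_nonneg h0] using h1)
    rw [← Complex.hasSum_ofReal]
    push_cast
    rw [sub_neg_eq_add] at this
    exact this.congr_fun fun p => by rw [h, neg_pow (r : ℂ)]; ring

theorem hasSum_bc_sub (k : ℤ) {z t : ℂ} (h : ‖t‖ < ‖z‖) :
    HasSum (fun p : ℕ => bc k p * z ^ (-k - 1 - p) * t ^ p) ((z - t) ^ (-k - 1)) := by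
  have hz : z ≠ 0 := norm_pos_iff.1 ((norm_nonneg t).trans_lt h)
  have h1 := (hasSum_bc k (x := t / z) (by
    rwa [norm_div, div_lt_one (norm_pos_iff.2 hz)])).mul_left (z ^ (-k - 1))
  rw [← mul_zpow, mul_sub, mul_one, mul_div_cancel₀ _ hz] at h1
  refine h1.congr_fun fun p => ?_
  rw [zpow_sub₀ hz, zpow_natCast, div_pow]
  ring

theorem summable_norm_bc_sub (k : ℤ) {z t : ℝ} (h0 : 0 ≤ t) (h : t < z) :
    ∃ s ≤ (z - t) ^ (-k - 1) + (z + t) ^ (-k - 1),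
      HasSum (fun p : ℕ => ‖bc k p‖ * z ^ (-k - 1 - p) * t ^ p) s := by
  have hz : 0 < z := h0.trans_lt h
  obtain ⟨s, hs, h1⟩ := hasSum_norm_bc k (r := t / z) (by positivity) (by rwa [div_lt_one hz])
  refine ⟨z ^ (-k - 1) * s, ?_, (h1.mul_left (z ^ (-k - 1))).congr_fun fun p => ?_⟩
  · have := mul_le_mul_of_nonneg_left hs (zpow_nonneg hz.le (-k - 1))
    rwa [mul_add, ← mul_zpow, ← mul_zpow, mul_sub, mul_add, mul_one,
      mul_div_cancel₀ _ hz.ne'] at this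
  · rw [zpow_sub₀ hz.ne', zpow_natCast, div_pow]
    ring

/-- Re-expansion of a Laurent series in `z - t` as a series in `z` and `t`. -/
theorem hasSum_reexpand {J : Type*} (e : J → ℤ) (g : J → ℂ) {z t : ℂ} (hzt : ‖t‖ < ‖z‖) {G : ℂ}
    (h : HasSum (fun j => g j * (z - t) ^ (-e j - 1)) G)
    (hm : Summable fun j => ‖g j‖ * (‖z‖ - ‖t‖) ^ (-e j - 1))
    (hp : Summable fun j => ‖g j‖ * (‖z‖ + ‖t‖) ^ (-e j - 1)) :
    HasSum (fun x : J × ℕ => g x.1 * bc (e x.1) x.2 * z ^ (-e x.1 - 1 - x.2) * t ^ x.2) G := by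
  have h1 : ∀ j, HasSum (fun p : ℕ => g j * bc (e j) p * z ^ (-e j - 1 - p) * t ^ p)
      (g j * (z - t) ^ (-e j - 1)) := fun j =>
    ((hasSum_bc_sub (e j) hzt).mul_left (g j)).congr_fun fun p => by ring
  have hs : Summable fun x : J × ℕ =>
      g x.1 * bc (e x.1) x.2 * z ^ (-e x.1 - 1 - x.2) * t ^ x.2 := by
    refine Summable.of_norm ?_
    rw [summable_prod_of_nonneg fun x => norm_nonneg _]
    refine ⟨fun j => (h1 j).summable.norm, ?_⟩
    refine Summable.of_nonneg_of_le (fun j => tsum_nonneg fun p => norm_nonneg _) (fun j => ?_)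
      (hm.add hp)
    obtain ⟨s, hs, h2⟩ := summable_norm_bc_sub (e j) (norm_nonneg t) hzt
    have h3 : HasSum (fun p : ℕ => ‖g j * bc (e j) p * z ^ (-e j - 1 - p) * t ^ p‖)
        (‖g j‖ * s) := (h2.mul_left ‖g j‖).congr_fun fun p => by
      simp only [norm_mul, norm_zpow, norm_pow]
      ring
    rw [h3.tsum_eq, ← mul_add]
    exact mul_le_mul_of_nonneg_left hs (norm_nonneg _)
  have h2 := hs.hasSum.prod_fiberwise h1
  rw [← h2.unique h]
  exact hs.hasSum

end Binomial

/-! ### Algebraic preliminaries on bimodules -/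

section Algebra

variable {V : Type*} [AddCommGroup V] [Module ℂ V]
variable {W : Type*} [AddCommGroup W] [Module ℂ W]

theorem CGrading.proj_d (G : CGrading W) (m : ℂ) (w : W) : G.proj m (G.d w) = m • G.proj m w := by
  have hfin : (Function.support fun n => n • G.proj n w).Finite :=
    (G.proj_finite w).subset fun n hn hn' => hn (by simp [hn'])
  have h1 := AddMonoidHom.map_finsum (G.proj m).toAddMonoidHom hfin
  simp only [LinearMap.toAddMonoidHom_coe] at h1
  have h2 : ∀ n, G.proj m (n • G.proj n w) = if n = m then m • G.proj m w else 0 := by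
    intro n
    have h := LinearMap.congr_fun (G.proj_comp m n) w
    rw [map_smul]
    by_cases hn : n = m
    · subst hn
      simp only [if_true] at h ⊢
      rw [show G.proj n (G.proj n w) = _ from h]
    · rw [if_neg hn]
      rw [if_neg (Ne.symm hn)] at h
      rw [show G.proj m (G.proj n w) = 0 from h, smul_zero]
  rw [CGrading.d, h1, finsum_congr h2, finsum_eq_single _ m fun n hn => if_neg hn, if_pos rfl]

theorem CGrading.d_proj (G : CGrading W) (m : ℂ) (w : W) : G.d (G.proj m w) = m • G.proj m w := by
  have h2 : ∀ n, n • G.proj n (G.proj m w) = if n = m then m • G.proj m w else 0 := by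
    intro n
    have h := LinearMap.congr_fun (G.proj_comp n m) w
    by_cases hn : n = m
    · subst hn
      simp only [if_true] at h ⊢
      rw [show G.proj n (G.proj n w) = _ from h]
    · rw [if_neg hn]
      rw [if_neg hn] at h
      rw [show G.proj n (G.proj m w) = 0 from h, smul_zero]
  rw [CGrading.d, finsum_congr h2, finsum_eq_single _ m fun n hn => if_neg hn, if_pos rfl]

theorem ZGrading.d_proj (G : ZGrading V) (m : ℤ) (w : V) :
    G.d (G.proj m w) = (m : ℂ) • G.proj m w := by
  have h2 : ∀ n : ℤ, (n : ℂ) • G.proj n (G.proj m w)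
      = if n = m then (m : ℂ) • G.proj m w else 0 := by
    intro n
    have h := LinearMap.congr_fun (G.proj_comp n m) w
    by_cases hn : n = m
    · subst hn
      simp only [if_true] at h ⊢
      rw [show G.proj n (G.proj n w) = _ from h]
    · rw [if_neg hn]
      rw [if_neg hn] at h
      rw [show G.proj n (G.proj m w) = 0 from h, smul_zero]
  rw [ZGrading.d, finsum_congr h2, finsum_eq_single _ m fun n hn => if_neg hn, if_pos rfl]

theorem CGrading.ext_functional (G : CGrading W) {φ ψ : W →ₗ[ℂ] ℂ}
    (h : ∀ n w, φ (G.proj n w) = ψ (G.proj n w)) : φ = ψ := by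
  ext w
  rw [← G.proj_sum w]
  have h1 := AddMonoidHom.map_finsum φ.toAddMonoidHom (G.proj_finite w)
  have h2 := AddMonoidHom.map_finsum ψ.toAddMonoidHom (G.proj_finite w)
  simp only [LinearMap.toAddMonoidHom_coe] at h1 h2
  rw [h1, h2]
  exact finsum_congr fun n => h n w

/-- A vector that is an eigenvector of `d` pairs trivially with functionals not supported in the
corresponding weight. -/
theorem CGrading.functional_eq_zero (G : CGrading W) {φ : W →ₗ[ℂ] ℂ} {m : ℂ} {w : W}
    (hw : G.d w = m • w) (hφ : φ ∘ₗ G.proj m = 0) : φ w = 0 := by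
  have h1 : ∀ n, n ≠ m → G.proj n w = 0 := by
    intro n hn
    have := G.proj_d n w
    rw [hw, map_smul, ← sub_eq_zero, ← sub_smul] at this
    exact (smul_eq_zero.1 this).resolve_left (sub_ne_zero.2 hn.symm)
  have h2 : G.proj m w = w := by
    conv_rhs => rw [← G.proj_sum w]
    rw [finsum_eq_single _ m h1]
  rw [← h2]
  exact LinearMap.congr_fun hφ w

variable {A : MOSVA V} (B : Bimod A W)

/-- The left vertex operator coefficient as a linear map. -/
def ylOp (u : V) (k : ℤ) : W →ₗ[ℂ] W := LinearMap.proj k ∘ₗ B.YL u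

@[simp]
theorem ylOp_apply (u : V) (k : ℤ) (w : W) : ylOp B u k w = B.YL u w k := rfl

/-- The divided power `D ^ m / m!`. -/
def dpow (m : ℕ) : W →ₗ[ℂ] W := ((m.factorial : ℂ)⁻¹) • B.DW ^ m

@[simp]
theorem dpow_zero : dpow B 0 = LinearMap.id := by
  ext
  simp [dpow]

theorem dpow_succ_apply (m : ℕ) (w : W) :
    dpow B (m + 1) w = ((m : ℂ) + 1)⁻¹ • dpow B m (B.DW w) := by
  simp only [dpow, LinearMap.smul_apply, pow_succ, Module.End.mul_apply, smul_smul,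
    Nat.factorial_succ]
  congr 1
  push_cast
  rw [mul_inv]

theorem dpow_succ_apply' (m : ℕ) (w : W) :
    dpow B (m + 1) w = ((m : ℂ) + 1)⁻¹ • B.DW (dpow B m w) := by
  simp only [dpow, LinearMap.smul_apply, map_smul, pow_succ', Module.End.mul_apply, smul_smul,
    Nat.factorial_succ]
  congr 1
  push_cast
  rw [mul_inv]

theorem dpow_DW (m : ℕ) (w : W) : dpow B m (B.DW w) = ((m : ℂ) + 1) • dpow B (m + 1) w := by
  rw [dpow_succ_apply, smul_smul, mul_inv_cancel₀ (Nat.cast_add_one_ne_zero m), one_smul]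

theorem YR_dpow (m : ℕ) (w : W) (v : V) (k : ℤ) :
    B.YR (dpow B m w) v k = ((-1) ^ m * bc (k - m) m) • B.YR w v (k - m) := by
  induction m generalizing k with
  | zero => simp
  | succ m ih =>
    rw [dpow_succ_apply', map_smul, LinearMap.smul_apply, Pi.smul_apply, B.D_derivR, ih, smul_smul,
      smul_smul]
    have e : k - 1 - (m : ℤ) = k - ((m + 1 : ℕ) : ℤ) := by push_cast; ring
    rw [e, bc_succ]
    congr 1
    generalize bc _ m = b
    push_cast
    have : (m : ℂ) + 1 ≠ 0 := Nat.cast_add_one_ne_zero m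
    field_simp
    ring

theorem YL_DW (u : V) (w : W) (k : ℤ) :
    B.YL u (B.DW w) k = B.DW (B.YL u w k) + (k : ℂ) • B.YL u w (k - 1) := by
  have := B.D_commL u w k
  rw [sub_eq_iff_eq_add] at this
  rw [this]
  module

theorem YL_dpow (u : V) (w : W) (m : ℕ) (k : ℤ) :
    B.YL u (dpow B m w) k = ∑ x ∈ Finset.HasAntidiagonal.antidiagonal m,
      bc (k - x.2) x.2 • dpow B x.1 (B.YL u w (k - x.2)) := by
  induction m generalizing w with
  | zero => simp
  | succ m ih =>
    have h0 : (m : ℂ) + 1 ≠ 0 := Nat.cast_add_one_ne_zero m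
    rw [← smul_right_injective W h0 |>.eq_iff]
    show ((m : ℂ) + 1) • _ = ((m : ℂ) + 1) • _
    have h1 : ((m : ℂ) + 1) • B.YL u (dpow B (m + 1) w) k = B.YL u (dpow B m (B.DW w)) k := by
      rw [dpow_DW, map_smul, Pi.smul_apply]
    have h2 : ∀ x ∈ Finset.HasAntidiagonal.antidiagonal m,
        bc (k - x.2) x.2 • dpow B x.1 (B.YL u (B.DW w) (k - x.2))
        = ((x.1 + 1 : ℕ) : ℂ) • (bc (k - x.2) x.2 • dpow B (x.1 + 1) (B.YL u w (k - x.2)))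
          + ((x.2 + 1 : ℕ) : ℂ) • (bc (k - (x.2 + 1 : ℕ)) (x.2 + 1) •
            dpow B x.1 (B.YL u w (k - (x.2 + 1 : ℕ)))) := by
      intro x _
      have e : bc (k - x.2) x.2 * ((k - x.2 : ℤ) : ℂ)
          = ((x.2 + 1 : ℕ) : ℂ) * bc (k - (x.2 + 1 : ℕ)) (x.2 + 1) := by
        have := bc_succ_mul (k - (x.2 + 1 : ℕ)) x.2
        have e' : k - ((x.2 + 1 : ℕ) : ℤ) + 1 = k - x.2 := by push_cast; ring
        rw [e'] at this
        rw [Nat.cast_succ, mul_comm _ (bc _ _), this, ← e']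
        push_cast
        rfl
      rw [YL_DW, map_add, map_smul, dpow_DW, smul_add, smul_smul, smul_smul, smul_smul, smul_smul,
        e, mul_comm (bc _ _)]
      congr 3
      · push_cast
        rfl
      · push_cast
        ring_nf
    rw [h1, ih, Finset.sum_congr rfl h2, Finset.sum_add_distrib]
    have e1 := Finset.Nat.sum_antidiagonal_succ (n := m) (f := fun x : ℕ × ℕ =>
      (x.1 : ℂ) • (bc (k - x.2) x.2 • dpow B x.1 (B.YL u w (k - x.2))))
    have e2 := Finset.Nat.sum_antidiagonal_succ' (n := m) (f := fun x : ℕ × ℕ =>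
      (x.2 : ℂ) • (bc (k - x.2) x.2 • dpow B x.1 (B.YL u w (k - x.2))))
    simp only [Nat.cast_zero, zero_smul, zero_add] at e1 e2
    rw [← e1, ← e2, ← Finset.sum_add_distrib, Finset.smul_sum]
    refine Finset.sum_congr rfl fun x hx => ?_
    rw [← add_smul, ← Nat.cast_add, Finset.HasAntidiagonal.mem_antidiagonal.1 hx]
    push_cast
    rfl

end Algebra

section GradedDual

variable {V : Type*} [AddCommGroup V] [Module ℂ V]
variable {W : Type*} [AddCommGroup W] [Module ℂ W]
variable {A : MOSVA V} (B : Bimod A W) {φ : W →ₗ[ℂ] ℂ}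

theorem InGradedDual.comp_ylOp (hφ : InGradedDual B.gr.proj φ) (u : V) (k : ℤ) :
    InGradedDual B.gr.proj (φ ∘ₗ ylOp B u k) := by
  have hu := A.gr.proj_finite u
  refine Set.Finite.subset (hu.biUnion (t := fun r : ℤ =>
    (fun n : ℂ => (r : ℂ) + (-(k : ℂ) - 1) + n) ⁻¹' Function.support fun i => φ ∘ₗ B.gr.proj i)
    fun r _ => hφ.preimage (add_right_injective _).injOn) fun n hn => ?_
  by_contra hcon
  simp only [Set.mem_iUnion, Set.mem_preimage, not_exists, Function.mem_support, not_not] at hcon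
  refine hn (LinearMap.ext fun w => ?_)
  have h0 : ∀ r, φ (B.YL (A.gr.proj r u) (B.gr.proj n w) k) = 0 := by
    intro r
    by_cases hr : A.gr.proj r u = 0
    · simp [hr]
    · refine B.gr.functional_eq_zero ?_ (hcon r hr)
      rw [B.d_commL, A.gr.d_proj, B.gr.d_proj, map_smul, map_smul, LinearMap.smul_apply,
        Pi.smul_apply, Pi.smul_apply, ← add_smul, ← add_smul]
  set T : V →ₗ[ℂ] ℂ := φ ∘ₗ LinearMap.proj k ∘ₗ B.YL.flip (B.gr.proj n w)
  have h1 := AddMonoidHom.map_finsum T.toAddMonoidHom hu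
  rw [A.gr.proj_sum] at h1
  show T u = 0
  refine Eq.trans h1 (finsum_eq_zero_of_forall_eq_zero fun r => h0 r)

theorem InGradedDual.comp_DW (hφ : InGradedDual B.gr.proj φ) :
    InGradedDual B.gr.proj (φ ∘ₗ B.DW) := by
  refine Set.Finite.subset (hφ.preimage (f := fun n : ℂ => n + 1) (add_left_injective _).injOn)
    fun n hn (hn' : φ ∘ₗ B.gr.proj (n + 1) = 0) => hn ?_
  show (φ ∘ₗ B.DW) ∘ₗ B.gr.proj n = 0
  rw [LinearMap.comp_assoc, B.DW_wt, ← LinearMap.comp_assoc, hn', LinearMap.zero_comp]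

theorem InGradedDual.smul (hφ : InGradedDual B.gr.proj φ) (c : ℂ) :
    InGradedDual B.gr.proj (c • φ) := by
  refine hφ.subset fun n hn (hn' : φ ∘ₗ B.gr.proj n = 0) => hn ?_
  show (c • φ) ∘ₗ B.gr.proj n = 0
  rw [LinearMap.smul_comp, hn', smul_zero]

theorem InGradedDual.comp_dpow (hφ : InGradedDual B.gr.proj φ) (m : ℕ) :
    InGradedDual B.gr.proj (φ ∘ₗ dpow B m) := by
  induction m with
  | zero => simpa using hφ
  | succ m ih =>
    convert (ih.comp_DW B).smul B ((m : ℂ) + 1)⁻¹ using 1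
    ext w
    simp [dpow_succ_apply]

theorem exists_comp_dpow_eq_zero (hφ : InGradedDual B.gr.proj φ) :
    ∃ M : ℕ, ∀ m, M ≤ m → φ ∘ₗ dpow B m = 0 := by
  obtain ⟨b, hb⟩ := B.gr.lower_bound
  obtain ⟨c, hc⟩ := (hφ.image Complex.re).bddAbove
  obtain ⟨M, hM⟩ := exists_nat_gt (c - b)
  refine ⟨M, fun m hm => B.gr.ext_functional fun n w => ?_⟩
  by_cases hn : n.re < b
  · simp [hb n hn]
  · have key : ∀ j : ℕ, dpow B j (B.gr.proj n w) = B.gr.proj (n + j) (dpow B j (B.gr.proj n w)) := by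
      intro j
      induction j with
      | zero =>
        have h := LinearMap.congr_fun (B.gr.proj_comp n n) w
        rw [if_pos rfl] at h
        simpa using h.symm
      | succ j ih =>
        have h := LinearMap.congr_fun (B.DW_wt (n + j)) (dpow B j (B.gr.proj n w))
        simp only [LinearMap.comp_apply] at h
        rw [← ih] at h
        rw [dpow_succ_apply', map_smul, Nat.cast_succ, ← add_assoc, ← h]
    rw [LinearMap.comp_apply, key m, LinearMap.zero_apply]
    have hz : φ ∘ₗ B.gr.proj (n + m) = 0 := by
      by_contra h
      have h1 := hc ⟨n + m, h, rfl⟩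
      simp only [Complex.add_re, Complex.natCast_re] at h1
      have : (M : ℝ) ≤ m := by exact_mod_cast hm
      linarith
    exact LinearMap.congr_fun hz _

theorem exists_YsR_eq_sum (v : V) (w : W) (k : ℤ) :
    ∃ N : ℕ, (∀ m : ℕ, N ≤ m → B.YR w v (k + m) = 0) ∧
      B.YsR v w k = ∑ m ∈ Finset.range N, (-1 : ℂ) ^ (k + m + 1) • dpow B m (B.YR w v (k + m)) := by
  obtain ⟨N, hN⟩ := B.truncR w v
  have hsub : ∀ m : ℕ, (N - k).toNat ≤ m → B.YR w v (k + m) = 0 := fun m hm => hN _ (by omega)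
  refine ⟨(N - k).toNat, hsub, ?_⟩
  rw [Bimod.YsR, finsum_eq_sum_of_support_subset (s := Finset.range (N - k).toNat)]
  · refine Finset.sum_congr rfl fun m _ => ?_
    rw [dpow, LinearMap.smul_apply, smul_smul]
  · intro m hm
    by_contra h
    exact hm (by simp [hsub m (by simpa using h)])

/-- The matrix coefficients of `Y_W^{s(R)}` in terms of divided powers of `D`. -/
theorem hasSum_YsR (ψ : W →ₗ[ℂ] ℂ) (v : V) (w : W) (k : ℤ) :
    HasSum (fun m : ℕ => (-1 : ℂ) ^ (k + m + 1) * ψ (dpow B m (B.YR w v (k + m))))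
      (ψ (B.YsR v w k)) := by
  obtain ⟨N, hN, h1⟩ := exists_YsR_eq_sum B v w k
  rw [h1, map_sum]
  simp only [map_smul, smul_eq_mul]
  exact hasSum_sum_of_ne_finset_zero fun m hm => by simp [hN m (by simpa using hm)]

theorem YsR_sum_smul (ψ : W →ₗ[ℂ] ℂ) (v : V) (k : ℤ) {α : Type*} (s : Finset α) (c : α → ℂ)
    (y : α → W) : ψ (B.YsR v (∑ j ∈ s, c j • y j) k) = ∑ j ∈ s, c j * ψ (B.YsR v (y j) k) := by
  refine (hasSum_YsR B ψ v _ k).unique ((hasSum_sum fun j _ =>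
    (hasSum_YsR B ψ v (y j) k).mul_left (c j)).congr_fun fun m => ?_)
  simp only [map_sum, map_smul, LinearMap.sum_apply, LinearMap.smul_apply, Finset.sum_apply,
    Pi.smul_apply, smul_eq_mul, Finset.mul_sum]
  exact Finset.sum_congr rfl fun j _ => by ring

/-- Iterated composition of linear maps. -/
def compLin {M : Type*} [AddCommGroup M] [Module ℂ M] :
    (n : ℕ) → (Fin n → (M →ₗ[ℂ] M)) → M →ₗ[ℂ] M
  | 0, _ => LinearMap.id
  | n + 1, f => f 0 ∘ₗ compLin n fun i => f i.succ

theorem compLin_apply {M : Type*} [AddCommGroup M] [Module ℂ M] (n : ℕ)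
    (f : Fin n → (M →ₗ[ℂ] M)) (w : M) :
    compLin n f w = compApply n (fun i => ⇑(f i)) w := by
  induction n with
  | zero => rfl
  | succ n ih => simp only [compLin, compApply, LinearMap.comp_apply, ih]

theorem compApply_castSucc {M : Type*} (n : ℕ) (f : Fin (n + 1) → (M → M)) (w : M) :
    compApply (n + 1) f w = compApply n (fun i => f i.castSucc) (f (Fin.last n) w) := by
  induction n with
  | zero => rfl
  | succ n ih =>
    rw [compApply, ih]
    rfl

theorem InGradedDual.comp_compLin (n : ℕ) (hφ : InGradedDual B.gr.proj φ)
    (u : Fin n → V) (k : Fin n → ℤ) :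
    InGradedDual B.gr.proj (φ ∘ₗ compLin n fun i => ylOp B (u i) (k i)) := by
  induction n generalizing φ with
  | zero => exact hφ
  | succ n ih =>
    rw [compLin, ← LinearMap.comp_assoc]
    exact ih (hφ.comp_ylOp B _ _) _ _

end GradedDual

/-! ### Commuting exponentials of `D_W` past products of left vertex operators -/

section Exponential

theorem HasSum.prod_range {K : Type*} {F : K → ℕ → ℂ} {G : ℕ → ℂ} {M : ℕ}
    (h0 : ∀ m, M ≤ m → ∀ x, F x m = 0) (h : ∀ m, HasSum (fun x => F x m) (G m)) :
    HasSum (fun x : K × ℕ => F x.1 x.2) (∑ m ∈ Finset.range M, G m) := by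
  have h1 : ∀ m, HasSum (fun x : K × ℕ => if x.2 = m then F x.1 x.2 else 0) (G m) := fun m => by
    have hi : Function.Injective (fun x : K => (x, m)) := fun x y hxy => (Prod.mk.inj hxy).1
    rw [← hi.hasSum_iff]
    · simpa [Function.comp_def] using h m
    · rintro ⟨x, j⟩ hx
      exact if_neg fun hj => hx ⟨x, by simp [show j = m from hj]⟩
  refine (hasSum_sum fun m (_ : m ∈ Finset.range M) => h1 m).congr_fun fun x => ?_
  rw [Finset.sum_ite_eq]
  split_ifs with hx
  · rfl
  · exact h0 _ (by simpa using hx) _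

/-- Regrouping a sum along `(k, m, p) ↦ (k + p, m + p)`. -/
theorem HasSum.regroup {α : Type*} {F : α → ℤ → ℕ → ℕ → ℂ} {s : ℂ}
    (h : HasSum (fun x : α × ℤ × ℕ × ℕ => F x.1 x.2.1 x.2.2.1 x.2.2.2) s) :
    HasSum (fun y : α × ℤ × ℕ => ∑ x ∈ Finset.HasAntidiagonal.antidiagonal y.2.2,
      F y.1 (y.2.1 - x.2) x.1 x.2) s := by
  let e : (Σ y : α × ℤ × ℕ, Finset.HasAntidiagonal.antidiagonal y.2.2) ≃ α × ℤ × ℕ × ℕ :=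
    { toFun := fun y => (y.1.1, y.1.2.1 - y.2.1.2, y.2.1.1, y.2.1.2)
      invFun := fun x => ⟨(x.1, x.2.1 + x.2.2.2, x.2.2.1 + x.2.2.2), ⟨(x.2.2.1, x.2.2.2), by simp⟩⟩
      left_inv := by
        rintro ⟨⟨a, k, m⟩, ⟨⟨i, j⟩, hij⟩⟩
        rw [Finset.HasAntidiagonal.mem_antidiagonal] at hij
        simp only at hij
        subst hij
        simp
      right_inv := by
        rintro ⟨a, k, i, j⟩
        simp }
  rw [← e.hasSum_iff] at h
  refine h.sigma fun y => ?_
  have := Finset.hasSum (Finset.HasAntidiagonal.antidiagonal y.2.2)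
    (fun x => F y.1 (y.2.1 - x.2) x.1 x.2)
  exact this

variable {V : Type*} [AddCommGroup V] [Module ℂ V]
variable {W : Type*} [AddCommGroup W] [Module ℂ W]
variable {A : MOSVA V} (B : Bimod A W)

/-- The product of the coefficients of left vertex operators. -/
def ylProd {l : ℕ} (u : Fin l → V) (k : Fin l → ℤ) : W →ₗ[ℂ] W :=
  compLin l fun i => ylOp B (u i) (k i)

theorem ylProd_snoc {l : ℕ} (u : Fin (l + 1) → V) (k : Fin l → ℤ) (k' : ℤ) (w : W) :
    ylProd B u (Fin.snoc k k' : Fin (l + 1) → ℤ) w =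
      ylProd B (fun i => u i.castSucc) k (B.YL (u (Fin.last l)) w k') := by
  rw [ylProd, ylProd, compLin_apply, compLin_apply, compApply_castSucc]
  simp

theorem mon_snoc {l : ℕ} (z : Fin (l + 1) → ℂ) (k : Fin l → ℤ) (k' : ℤ) :
    mon z (Fin.snoc k k' : Fin (l + 1) → ℤ) =
      mon (fun i => z i.castSucc) k * z (Fin.last l) ^ (-k' - 1) := by
  rw [mon, Fin.prod_univ_castSucc]
  simp [mon]

/-- The bijection splitting off the last exponent. -/
def snocIdx (l : ℕ) (κ : Type*) : (Fin l → ℤ) × (ℤ × κ) ≃ (Fin (l + 1) → ℤ) × κ where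
  toFun x := (Fin.snoc x.1 x.2.1, x.2.2)
  invFun y := (fun i => y.1 i.castSucc, y.1 (Fin.last l), y.2)
  left_inv x := by simp
  right_inv y := by
    refine Prod.ext (funext fun i => ?_) rfl
    refine Fin.lastCases ?_ (fun j => ?_) i <;> simp

/-- Expansion of `⟨φ, Y_W^L(u₁,z₁)⋯Y_W^L(u_l,z_l) e^{tD} X⟩`. -/
theorem hasSum_ylProd_dpow {M : ℕ} {φ : W →ₗ[ℂ] ℂ} (hφ : ∀ m, M ≤ m → φ ∘ₗ dpow B m = 0)
    {l : ℕ} (u : Fin l → V) (z : Fin l → ℂ) (t : ℂ) (hz : ∀ i, ‖t‖ < ‖z i‖)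
    {κ : Type*} (X : κ → W) (μ : κ → ℂ)
    (H : ∀ (m : ℕ) (y : Fin l → ℂ), (∀ i, |‖y i‖ - ‖z i‖| ≤ ‖t‖) →
      Summable fun K : (Fin l → ℤ) × κ =>
        φ (dpow B m (ylProd B u K.1 (X K.2))) * mon y K.1 * μ K.2) :
    HasSum (fun x : (Fin l → ℤ) × κ × ℕ =>
        φ (ylProd B u x.1 (dpow B x.2.2 (X x.2.1))) * mon z x.1 * μ x.2.1 * t ^ x.2.2)
      (∑ m ∈ Finset.range M, (∑' K : (Fin l → ℤ) × κ,
        φ (dpow B m (ylProd B u K.1 (X K.2))) * mon (fun i => z i - t) K.1 * μ K.2) * t ^ m) := by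
  induction l generalizing κ with
  | zero =>
    have h1 := HasSum.prod_range (K := (Fin 0 → ℤ) × κ) (M := M)
      (F := fun K m => φ (dpow B m (ylProd B u K.1 (X K.2))) * mon (fun i => z i - t) K.1
        * μ K.2 * t ^ m) (fun m hm x => by
          have := LinearMap.congr_fun (hφ m hm) (ylProd B u x.1 (X x.2))
          simp only [LinearMap.comp_apply, LinearMap.zero_apply] at this
          simp [this]) (fun m => ((H m (fun i => z i - t) fun i => i.elim0).hasSum).mul_right _)
    rw [← (Equiv.prodAssoc (Fin 0 → ℤ) κ ℕ).hasSum_iff]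
    refine h1.congr_fun fun x => ?_
    simp [mon, ylProd, compLin]
  | succ l ih =>
    set v : V := u (Fin.last l)
    set u' : Fin l → V := fun i => u i.castSucc
    set z' : Fin l → ℂ := fun i => z i.castSucc
    set zl : ℂ := z (Fin.last l)
    have hzl : ‖t‖ < ‖zl‖ := hz _
    have IH : ∀ c : ℂ, |‖c‖ - ‖zl‖| ≤ ‖t‖ → HasSum (fun x : (Fin l → ℤ) × (ℤ × κ) × ℕ =>
        φ (ylProd B u' x.1 (dpow B x.2.2 (B.YL v (X x.2.1.2) x.2.1.1))) * mon z' x.1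
          * (c ^ (-x.2.1.1 - 1) * μ x.2.1.2) * t ^ x.2.2)
        (∑ m ∈ Finset.range M, (∑' K : (Fin l → ℤ) × (ℤ × κ),
          φ (dpow B m (ylProd B u' K.1 (B.YL v (X K.2.2) K.2.1))) * mon (fun i => z' i - t) K.1
            * (c ^ (-K.2.1 - 1) * μ K.2.2)) * t ^ m) := by
      intro c hc
      refine ih u' z' (fun i => hz _) (fun x : ℤ × κ => B.YL v (X x.2) x.1)
        (fun x => c ^ (-x.1 - 1) * μ x.2) fun m y hy => ?_
      have h1 := H m (Fin.snoc y c : Fin (l + 1) → ℂ) fun i => by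
        refine Fin.lastCases ?_ (fun j => ?_) i
        · simpa using hc
        · simpa using hy j
      rw [← (snocIdx l κ).summable_iff] at h1
      refine h1.congr fun x => ?_
      simp only [Function.comp_apply, snocIdx, Equiv.coe_fn_mk, ylProd_snoc, mon_snoc,
        Fin.snoc_castSucc, Fin.snoc_last, u', v]
      ring
    have hsub : |‖zl - t‖ - ‖zl‖| ≤ ‖t‖ := by
      have := abs_norm_sub_norm_le (zl - t) zl
      simpa using this
    have S : ∀ c : ℂ, |‖c‖ - ‖zl‖| ≤ ‖t‖ → Summable fun x : (Fin l → ℤ) × (ℤ × κ) × ℕ =>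
        ‖φ (ylProd B u' x.1 (dpow B x.2.2 (B.YL v (X x.2.1.2) x.2.1.1))) * mon z' x.1
          * μ x.2.1.2 * t ^ x.2.2‖ * ‖c‖ ^ (-x.2.1.1 - 1) := by
      intro c hc
      refine (IH c hc).summable.norm.congr fun x => ?_
      simp only [norm_mul, norm_zpow]
      ring
    have n1 : ‖((‖zl‖ - ‖t‖ : ℝ) : ℂ)‖ = ‖zl‖ - ‖t‖ := by
      rw [Complex.norm_real, Real.norm_eq_abs, abs_of_pos (by linarith)]
    have n2 : ‖((‖zl‖ + ‖t‖ : ℝ) : ℂ)‖ = ‖zl‖ + ‖t‖ := by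
      rw [Complex.norm_real, Real.norm_eq_abs, abs_of_pos (by linarith [norm_nonneg t])]
    have hm := S ((‖zl‖ - ‖t‖ : ℝ) : ℂ) (by rw [n1]; simp)
    have hp := S ((‖zl‖ + ‖t‖ : ℝ) : ℂ) (by rw [n2]; simp)
    rw [n1] at hm
    rw [n2] at hp
    have R := hasSum_reexpand (J := (Fin l → ℤ) × (ℤ × κ) × ℕ) (fun x => x.2.1.1)
      (fun x => φ (ylProd B u' x.1 (dpow B x.2.2 (B.YL v (X x.2.1.2) x.2.1.1))) * mon z' x.1
          * μ x.2.1.2 * t ^ x.2.2) hzl ((IH _ hsub).congr_fun fun x => by ring) hm hp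
    let e : ((Fin l → ℤ) × κ) × ℤ × ℕ × ℕ ≃ ((Fin l → ℤ) × (ℤ × κ) × ℕ) × ℕ :=
      { toFun := fun x => ((x.1.1, (x.2.1, x.1.2), x.2.2.1), x.2.2.2)
        invFun := fun x => ((x.1.1, x.1.2.1.2), x.1.2.1.1, x.1.2.2, x.2)
        left_inv := fun x => rfl
        right_inv := fun x => rfl }
    rw [← e.hasSum_iff] at R
    have R2 := HasSum.regroup (F := fun (a : (Fin l → ℤ) × κ) (k : ℤ) (m p : ℕ) =>
      φ (ylProd B u' a.1 (dpow B m (B.YL v (X a.2) k))) * mon z' a.1 * μ a.2 * t ^ m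
        * bc k p * zl ^ (-k - 1 - p) * t ^ p) R
    let e2 : ((Fin l → ℤ) × κ) × ℤ × ℕ ≃ (Fin (l + 1) → ℤ) × κ × ℕ :=
      { toFun := fun x => (Fin.snoc x.1.1 x.2.1, x.1.2, x.2.2)
        invFun := fun y => ((fun i => y.1 i.castSucc, y.2.1), y.1 (Fin.last l), y.2.2)
        left_inv := fun x => by simp
        right_inv := fun y => by
          refine Prod.ext (funext fun i => ?_) rfl
          refine Fin.lastCases ?_ (fun j => ?_) i <;> simp }
    rw [← e2.hasSum_iff]
    have hval : ∀ m, (∑' K : (Fin l → ℤ) × (ℤ × κ),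
          φ (dpow B m (ylProd B u' K.1 (B.YL v (X K.2.2) K.2.1))) * mon (fun i => z' i - t) K.1
            * ((zl - t) ^ (-K.2.1 - 1) * μ K.2.2)) = ∑' K : (Fin (l + 1) → ℤ) × κ,
        φ (dpow B m (ylProd B u K.1 (X K.2))) * mon (fun i => z i - t) K.1 * μ K.2 := by
      intro m
      rw [← (snocIdx l κ).tsum_eq]
      refine tsum_congr fun x => ?_
      simp only [snocIdx, Equiv.coe_fn_mk, ylProd_snoc, mon_snoc, u', v, z', zl]
      ring
    simp only [hval] at R2
    refine R2.congr_fun fun x => ?_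
    obtain ⟨⟨k, a⟩, K, N⟩ := x
    simp only [Function.comp_apply, e2, Equiv.coe_fn_mk, ylProd_snoc, mon_snoc, YL_dpow, map_sum,
      map_smul, smul_eq_mul, Finset.sum_mul]
    refine Finset.sum_congr rfl fun x hx => ?_
    rw [Finset.HasAntidiagonal.mem_antidiagonal] at hx
    rw [← hx, pow_add, show -(K - (x.2 : ℤ)) - 1 - x.2 = -K - 1 by ring]
    ring

end Exponential

/-! ### Series with a single opposite right vertex operator -/

section SingleRight

variable {V : Type*} [AddCommGroup V] [Module ℂ V]
variable {W : Type*} [AddCommGroup W] [Module ℂ W]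
variable {A : MOSVA V} (B : Bimod A W)

/-- The iterate `Y_V(v₀)_{k₀}⋯Y_V(v_{q-1})_{k_{q-1}} v_q`. -/
def yProd (A : MOSVA V) {q : ℕ} (v : Fin (q + 1) → V) (k : Fin q → ℤ) : V :=
  compApply q (fun j x => A.Y (v j.castSucc) x (k j)) (v (Fin.last q))

/-- Rationality of `⟨φ, Y_W^L(u₁,z₁)⋯Y_W^L(u_l,z_l) Y_W^{s(R)}(Y_V(v₀,x₀)⋯v_q, t) w⟩` near a
torus. -/
theorem exists_hasSum_ylProd_YsR {φ : W →ₗ[ℂ] ℂ} (hφ : InGradedDual B.gr.proj φ)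
    {l q : ℕ} (u : Fin l → V) (v : Fin (q + 1) → V) (w : W) :
    ∃ (M : ℕ) (R : ℕ → RatFn (Fin l ⊕ Fin (q + 1))),
      ∀ (z : Fin l → ℂ) (t : ℂ) (x : Fin q → ℂ), t ≠ 0 → (∀ i, x i ≠ 0) → Ordered x →
        (∀ i, ‖x i‖ < ‖t‖) → (∀ i, 2 * ‖t‖ < ‖z i‖) →
        (∀ i j, i < j → ‖z j‖ + 2 * ‖t‖ < ‖z i‖) →
        HasSum (fun K : (Fin l → ℤ) × ℤ × (Fin q → ℤ) =>
          φ (ylProd B u K.1 (B.YsR (yProd A v K.2.2) w K.2.1)) *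
            (mon z K.1 * t ^ (-K.2.1 - 1) * mon x K.2.2))
          (∑ m ∈ Finset.range M,
            (R m).eval (Sum.elim (fun i => z i - t) (Fin.cons (-t) x)) * t ^ m) := by
  obtain ⟨M, hM⟩ := exists_comp_dpow_eq_zero B hφ
  choose R hR using fun m => B.compatRat l q u w v (φ ∘ₗ dpow B m) (hφ.comp_dpow B m)
  refine ⟨M, R, fun z t x ht hx0 hxo hxt hzt hzo => ?_⟩
  have ht' : 0 < ‖t‖ := norm_pos_iff.2 ht
  have key : ∀ (m : ℕ) (y : Fin l → ℂ), (∀ i, |‖y i‖ - ‖z i‖| ≤ ‖t‖) →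
      HasSum (fun K : (Fin l → ℤ) × ℤ × (Fin q → ℤ) =>
        φ (dpow B m (ylProd B u K.1 (B.YR w (yProd A v K.2.2) K.2.1))) * mon y K.1 *
          ((-t) ^ (-K.2.1 - 1) * mon x K.2.2))
        ((R m).eval (Sum.elim y (Fin.cons (-t) x))) := by
    intro m y hy
    have hy' : ∀ i, ‖z i‖ - ‖t‖ ≤ ‖y i‖ ∧ ‖y i‖ ≤ ‖z i‖ + ‖t‖ := fun i => by
      have := abs_le.1 (hy i)
      constructor <;> linarith
    have := (hR m y (-t) x (fun i j hij => by linarith [(hy' i).1, (hy' j).2, hzo i j hij])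
      (fun i => by rw [norm_neg]; linarith [(hy' i).1, hzt i])
      (fun j => by rw [norm_neg]; exact hxt j) hxo (by rwa [norm_neg])
      (fun j => norm_pos_iff.2 (hx0 j))).2
    refine this.congr_fun fun K => ?_
    simp only [LinearMap.comp_apply, ylProd, compLin_apply, mon, yProd]
    simp only [← mul_assoc]
    rfl
  have h1 := hasSum_ylProd_dpow B hM u z t (fun i => by linarith [hzt i])
    (κ := ℤ × (Fin q → ℤ)) (fun x => B.YR w (yProd A v x.2) x.1)
    (fun K => (-t) ^ (-K.1 - 1) * mon x K.2) (fun m y hy => (key m y hy).summable)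
  have hval : ∀ m, (∑' K : (Fin l → ℤ) × ℤ × (Fin q → ℤ),
      φ (dpow B m (ylProd B u K.1 (B.YR w (yProd A v K.2.2) K.2.1))) *
        mon (fun i => z i - t) K.1 * ((-t) ^ (-K.2.1 - 1) * mon x K.2.2)) =
      (R m).eval (Sum.elim (fun i => z i - t) (Fin.cons (-t) x)) := fun m =>
    (key m _ fun i => by
      have := abs_norm_sub_norm_le (z i - t) (z i)
      simpa using this).tsum_eq
  simp only [hval] at h1
  let e : ((Fin l → ℤ) × ℤ × (Fin q → ℤ)) × ℕ ≃ (Fin l → ℤ) × (ℤ × (Fin q → ℤ)) × ℕ :=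
    { toFun := fun x => (x.1.1, (x.1.2.1 + x.2, x.1.2.2), x.2)
      invFun := fun x => ((x.1, x.2.1.1 - x.2.2, x.2.1.2), x.2.2)
      left_inv := fun x => by simp
      right_inv := fun x => by simp }
  rw [← e.hasSum_iff] at h1
  refine h1.prod_fiberwise fun K => ?_
  obtain ⟨k, k', j⟩ := K
  have h2 := (hasSum_YsR B (φ ∘ₗ ylProd B u k) (yProd A v j) w k').mul_right
    (mon z k * t ^ (-k' - 1) * mon x j)
  refine h2.congr_fun fun m => ?_
  simp only [Function.comp_apply, e, Equiv.coe_fn_mk, LinearMap.comp_apply]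
  have h3 : (-t) ^ (-(k' + m : ℤ) - 1) * t ^ m = (-1) ^ (k' + m + 1) * t ^ (-k' - 1) := by
    rw [neg_eq_neg_one_mul, mul_zpow, mul_assoc, ← zpow_natCast t m, ← zpow_add₀ ht]
    congr 1
    · rw [show -(k' + m : ℤ) - 1 = -(k' + m + 1) by ring, zpow_neg, ← inv_zpow]
      norm_num
    · congr 1
      ring
  linear_combination φ (ylProd B u k (dpow B m (B.YR w (yProd A v j) (k' + m)))) * mon z k *
    mon x j * h3

end SingleRight

/-! ### Functions represented by rational functions with the allowed poles -/

section IsRat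

variable {ι : Type*} [Fintype ι] [DecidableEq ι]

/-- A function which agrees with a `RatFn` away from its possible poles. -/
def IsRat (F : (ι → ℂ) → ℂ) : Prop :=
  ∃ R : RatFn ι, ∀ z : ι → ℂ, (∀ i, z i ≠ 0) → Conf z → F z = R.eval z

variable {F G : (ι → ℂ) → ℂ}

theorem RatFn.denom_ne_zero (R : RatFn ι) {z : ι → ℂ} (h0 : ∀ i, z i ≠ 0) (hz : Conf z) :
    (∏ i, z i ^ R.a i) * ∏ q ∈ Finset.univ.offDiag, (z q.1 - z q.2) ^ R.b q.1 q.2 ≠ 0 :=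
  mul_ne_zero (Finset.prod_ne_zero_iff.2 fun i _ => pow_ne_zero _ (h0 i))
    (Finset.prod_ne_zero_iff.2 fun _ hq =>
      pow_ne_zero _ (sub_ne_zero.2 (hz _ _ (Finset.mem_offDiag.1 hq).2.2)))

theorem IsRat.congr (hF : IsRat F)
    (h : ∀ z : ι → ℂ, (∀ i, z i ≠ 0) → Conf z → F z = G z) : IsRat G := by
  obtain ⟨R, hR⟩ := hF
  exact ⟨R, fun z h0 hz => by rw [← h z h0 hz, hR z h0 hz]⟩

theorem IsRat.poly (P : MvPolynomial ι ℂ) : IsRat (fun z => MvPolynomial.eval z P) :=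
  ⟨⟨P, 0, 0⟩, fun z _ _ => by simp [RatFn.eval]⟩

theorem IsRat.const (c : ℂ) : IsRat (fun _ : ι → ℂ => c) := by
  simpa using IsRat.poly (ι := ι) (MvPolynomial.C c)

theorem IsRat.coord (i : ι) : IsRat (fun z : ι → ℂ => z i) := by
  simpa using IsRat.poly (ι := ι) (MvPolynomial.X i)

theorem IsRat.mul (hF : IsRat F) (hG : IsRat G) : IsRat (fun z => F z * G z) := by
  obtain ⟨R, hR⟩ := hF
  obtain ⟨S, hS⟩ := hG
  refine ⟨⟨R.num * S.num, fun i => R.a i + S.a i, fun i j => R.b i j + S.b i j⟩,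
    fun z h0 hz => ?_⟩
  beta_reduce
  rw [hR z h0 hz, hS z h0 hz]
  simp only [RatFn.eval, map_mul, pow_add, Finset.prod_mul_distrib]
  rw [div_mul_div_comm]
  ring

/-- The denominator of a `RatFn` as a polynomial. -/
def RatFn.denom (R : RatFn ι) : MvPolynomial ι ℂ :=
  (∏ i, MvPolynomial.X i ^ R.a i) *
    ∏ q ∈ Finset.univ.offDiag, (MvPolynomial.X q.1 - MvPolynomial.X q.2) ^ R.b q.1 q.2

theorem RatFn.eval_denom (R : RatFn ι) (z : ι → ℂ) : MvPolynomial.eval z R.denom =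
    (∏ i, z i ^ R.a i) * ∏ q ∈ Finset.univ.offDiag, (z q.1 - z q.2) ^ R.b q.1 q.2 := by
  simp [RatFn.denom, map_prod]

theorem IsRat.add (hF : IsRat F) (hG : IsRat G) : IsRat (fun z => F z + G z) := by
  obtain ⟨R, hR⟩ := hF
  obtain ⟨S, hS⟩ := hG
  refine ⟨⟨R.num * S.denom + S.num * R.denom, fun i => R.a i + S.a i,
    fun i j => R.b i j + S.b i j⟩, fun z h0 hz => ?_⟩
  have h1 := R.denom_ne_zero h0 hz
  have h2 := S.denom_ne_zero h0 hz
  beta_reduce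
  rw [hR z h0 hz, hS z h0 hz]
  simp only [RatFn.eval, map_add, map_mul, RatFn.eval_denom, pow_add, Finset.prod_mul_distrib]
  rw [div_add_div _ _ h1 h2]
  congr 1 <;> ring

theorem IsRat.neg (hF : IsRat F) : IsRat (fun z => -F z) := by
  simpa using (IsRat.const (-1)).mul hF

theorem IsRat.sub (hF : IsRat F) (hG : IsRat G) : IsRat (fun z => F z - G z) := by
  simpa only [sub_eq_add_neg] using hF.add hG.neg

theorem IsRat.pow (hF : IsRat F) (n : ℕ) : IsRat (fun z => F z ^ n) := by
  induction n with
  | zero => simpa using IsRat.const 1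
  | succ n ih => simpa only [pow_succ] using ih.mul hF

theorem IsRat.prod {α : Type*} (s : Finset α) {H : α → (ι → ℂ) → ℂ}
    (h : ∀ a ∈ s, IsRat (H a)) : IsRat (fun z => ∏ a ∈ s, H a z) := by
  classical
  induction s using Finset.induction_on with
  | empty => simpa using IsRat.const 1
  | insert a s ha ih =>
    simp only [Finset.prod_insert ha]
    exact (h a (by simp)).mul (ih fun b hb => h b (by simp [hb]))

theorem IsRat.sum {α : Type*} (s : Finset α) {H : α → (ι → ℂ) → ℂ}
    (h : ∀ a ∈ s, IsRat (H a)) : IsRat (fun z => ∑ a ∈ s, H a z) := by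
  classical
  induction s using Finset.induction_on with
  | empty => simpa using IsRat.const 0
  | insert a s ha ih =>
    simp only [Finset.sum_insert ha]
    exact (h a (by simp)).add (ih fun b hb => h b (by simp [hb]))

theorem IsRat.inv_coord (i : ι) : IsRat (fun z : ι → ℂ => (z i)⁻¹) := by
  refine ⟨⟨1, fun j => if i = j then 1 else 0, 0⟩, fun z _ _ => ?_⟩
  simp only [RatFn.eval, map_one, Finset.prod_pow_boole]
  simp

theorem IsRat.inv_sub {i j : ι} (hij : i ≠ j) : IsRat (fun z : ι → ℂ => (z i - z j)⁻¹) := by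
  refine ⟨⟨1, 0, fun a b => if (i, j) = (a, b) then 1 else 0⟩, fun z _ _ => ?_⟩
  simp only [RatFn.eval, map_one, Finset.prod_pow_boole]
  simp [hij]

theorem IsRat.comp {κ : Type*} [Fintype κ] [DecidableEq κ] (R : RatFn κ)
    {H : κ → (ι → ℂ) → ℂ} (h : ∀ j, IsRat (H j)) (hinv : ∀ j, IsRat (fun z => (H j z)⁻¹))
    (hsub : ∀ j k, j ≠ k → IsRat (fun z => (H j z - H k z)⁻¹)) :
    IsRat (fun z => R.eval (fun j => H j z)) := by
  have hnum : ∀ P : MvPolynomial κ ℂ, IsRat (fun z => MvPolynomial.eval (fun j => H j z) P) := by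
    intro P
    induction P using MvPolynomial.induction_on with
    | C c => simpa using IsRat.const c
    | add P Q hP hQ => simpa using hP.add hQ
    | mul_X P j hP => simpa using hP.mul (h j)
  have h2 := (hnum R.num).mul ((IsRat.prod Finset.univ fun j _ => (hinv j).pow (R.a j)).mul
    (IsRat.prod Finset.univ.offDiag fun q hq =>
      (hsub q.1 q.2 (Finset.mem_offDiag.1 hq).2.2).pow (R.b q.1 q.2)))
  refine h2.congr fun z _ _ => ?_
  simp only [RatFn.eval, div_eq_mul_inv, mul_inv, inv_pow, Finset.prod_inv_distrib]

end IsRat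

section BlockConf

variable {n : ℕ} {p : Fin n} {q : ℕ} {ζ : Fin n → ℂ}

theorem BlockRegion.shift_ne_zero (h : BlockRegion p q ζ) (i : Fin n) :
    shiftBlock p q ζ i ≠ 0 := by
  by_cases hi : InBlock p q i
  · rw [shiftBlock_of_mem hi]
    intro h0
    have h1 := h.block i hi
    rw [eq_neg_of_add_eq_zero_left h0, norm_neg] at h1
    exact lt_irrefl _ h1
  · rw [shiftBlock_of_notMem hi]
    exact h.ne_zero i

theorem BlockRegion.shift_ne_of_lt (h : BlockRegion p q ζ) {i j : Fin n} (hij : i < j) :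
    shiftBlock p q ζ i ≠ shiftBlock p q ζ j := by
  intro he
  by_cases hi : InBlock p q i <;> by_cases hj : InBlock p q j
  · rw [shiftBlock_of_mem hi, shiftBlock_of_mem hj, add_right_inj] at he
    exact absurd (h.block_block i j hi hj hij) (by rw [he]; exact lt_irrefl _)
  · rw [shiftBlock_of_mem hi, shiftBlock_of_notMem hj] at he
    have h1 : (p + q : ℕ) < j := by
      by_contra hc
      exact hj ⟨hi.1.trans hij, by omega⟩
    have h2 := h.block_right i j hi h1
    have h3 : ‖ζ p‖ ≤ ‖ζ p + ζ i‖ + ‖ζ i‖ := by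
      simpa using norm_sub_le (ζ p + ζ i) (ζ i)
    rw [he] at h3
    linarith
  · rw [shiftBlock_of_notMem hi, shiftBlock_of_mem hj] at he
    rcases lt_trichotomy i p with h1 | h1 | h1
    · have h2 := h.left_block i j h1 hj
      rw [he] at h2
      linarith [norm_add_le (ζ p) (ζ j)]
    · rw [h1, left_eq_add] at he
      exact h.ne_zero j he
    · exact hi ⟨h1, by have := hj.2; rw [Fin.lt_def] at hij; omega⟩
  · rw [shiftBlock_of_notMem hi, shiftBlock_of_notMem hj] at he
    have h2 : ‖ζ j‖ < ‖ζ i‖ := by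
      by_cases h1 : i ≤ p
      · by_cases h3 : j ≤ p
        · exact h.left i j hij h3
        · refine h.left_right i j h1 ?_
          by_contra hc
          exact hj ⟨not_le.1 h3, by omega⟩
      · refine h.right i j ?_ hij
        by_contra hc
        exact hi ⟨not_le.1 h1, by omega⟩
    rw [he] at h2
    exact lt_irrefl _ h2

theorem BlockRegion.conf (h : BlockRegion p q ζ) : Conf (shiftBlock p q ζ) := fun i j hij => by
  rcases lt_or_gt_of_ne hij with h1 | h1
  · exact h.shift_ne_of_lt h1
  · exact (h.shift_ne_of_lt h1).symm

/-- If a Laurent series expands a rational function on one torus in the region, then it does so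
in the whole region. -/
theorem hasSum_of_torus (R : RatFn (Fin n)) (c : (Fin n → ℤ) → ℂ) (r : Fin n → ℝ)
    (hr : ∀ i, 0 < r i) (hΩ : ∀ z : Fin n → ℂ, (∀ i, ‖z i‖ = r i) → BlockRegion p q z)
    (h : ∀ z : Fin n → ℂ, (∀ i, ‖z i‖ = r i) →
      HasSum (fun k => c k * mon z k) (R.eval (shiftBlock p q z))) :
    ∀ z, BlockRegion p q z → HasSum (fun k => c k * mon z k) (R.eval (shiftBlock p q z)) := by
  obtain ⟨f, hf⟩ := expandable_ratFn p q R
  have h1 := laurent_unique r hr (fun k => c k - f k) fun z hz => by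
    have := (h z hz).sub (hf z (hΩ z hz))
    rw [sub_self] at this
    exact this.congr_fun fun k => by rw [sub_mul]
  have h2 : c = f := by
    funext k
    exact sub_eq_zero.1 (congrFun h1 k)
  rw [h2]
  exact fun z hz => hf z hz

end BlockConf

/-! ### The coefficients with an iterated block -/

section BlockCoeff

variable {V : Type*} [AddCommGroup V] [Module ℂ V]
variable {W : Type*} [AddCommGroup W] [Module ℂ W]
variable {A : MOSVA V}

/-- Extension of a tuple of exponents by zero. -/
def extZ {n : ℕ} (k : Fin n → ℤ) (i : ℕ) : ℤ := if h : i < n then k ⟨i, h⟩ else 0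

theorem extZ_of_lt {n : ℕ} (k : Fin n → ℤ) {i : ℕ} (h : i < n) : extZ k i = k ⟨i, h⟩ := dif_pos h

/-- The iterate `Y(u_{p+q})_{k_{p+q}}⋯Y(u_{p+1})_{k_{p+1}} u_p`. -/
def iterV (A : MOSVA V) (u : ℕ → V) (k : ℕ → ℤ) (p : ℕ) : ℕ → V
  | 0 => u p
  | q + 1 => A.Y (u (p + q + 1)) (iterV A u k p q) (k (p + q + 1))

/-- The product of the coefficients of `c` opposite right vertex operators, starting with the
index `i`. -/
def ysProd (B : Bimod A W) (u : ℕ → V) (k : ℕ → ℤ) : ℕ → ℕ → W → W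
  | _, 0, w => w
  | i, c + 1, w => B.YsR (u i) (ysProd B u k (i + 1) c w) (k i)

/-- The coefficients of the series with `p` left vertex operators, followed by the opposite right
vertex operator of an iterate of length `q + 1`, and by the other opposite right vertex
operators. -/
def blockCoeff (B : Bimod A W) (φ : W →ₗ[ℂ] ℂ) (u : ℕ → V) (w : W) (n p q : ℕ)
    (k : Fin n → ℤ) : ℂ :=
  φ (ylProd B (fun i : Fin p => u i) (fun i : Fin p => extZ k i)
    (B.YsR (iterV A u (extZ k) p q) (ysProd B u (extZ k) (p + q + 1) (n - (p + q + 1)) w)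
      (extZ k p)))

theorem iterV_eq (u : ℕ → V) (k : ℕ → ℤ) (p q : ℕ) :
    iterV A u k p q = yProd A (fun j : Fin (q + 1) => u (p + q - j))
      (fun j : Fin q => k (p + q - j)) := by
  induction q with
  | zero => simp [iterV, yProd, compApply]
  | succ q ih =>
    rw [iterV, ih]
    simp only [yProd, compApply, Fin.val_castSucc, Fin.val_last, Fin.val_zero, Fin.val_succ]
    have h1 : ∀ j : ℕ, p + (q + 1) - (j + 1) = p + q - j := fun j => by omega
    simp only [h1]
    simp [add_assoc]

/-- The indices `0, …, p - 1`, `p`, and `p + q, …, p + 1`. -/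
def blockIdx (p q : ℕ) : Fin p ⊕ Fin (q + 1) → Fin (p + q + 1) :=
  Sum.elim (fun i => ⟨i, by omega⟩)
    (Fin.cons ⟨p, by omega⟩ fun j => ⟨p + q - j, by omega⟩)

theorem blockIdx_bijective (p q : ℕ) : Function.Bijective (blockIdx p q) := by
  rw [Fintype.bijective_iff_injective_and_card]
  refine ⟨?_, by simp [add_assoc]⟩
  rintro (i | i) (j | j) h
  · simpa [blockIdx, Fin.ext_iff] using h
  · refine Fin.cases (fun h => ?_) (fun j h => ?_) j h <;> simp [blockIdx] at h <;> omega
  · refine Fin.cases (fun h => ?_) (fun j h => ?_) i h <;> simp [blockIdx] at h <;> omega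
  · revert h
    refine Fin.cases ?_ (fun i => ?_) i <;> refine Fin.cases ?_ (fun j => ?_) j <;> intro h <;>
      simp [blockIdx] at h ⊢ <;> omega

/-- Splitting of the exponents according to `blockIdx`. -/
def blockExp (p q : ℕ) : (Fin (p + q + 1) → ℤ) ≃ (Fin p → ℤ) × ℤ × (Fin q → ℤ) where
  toFun k := (fun i => k (blockIdx p q (.inl i)), k (blockIdx p q (.inr 0)),
    fun j => k (blockIdx p q (.inr j.succ)))
  invFun K := fun i => Sum.elim K.1 (Fin.cons K.2.1 K.2.2 : Fin (q + 1) → ℤ)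
    ((Equiv.ofBijective _ (blockIdx_bijective p q)).symm i)
  left_inv k := by
    funext i
    obtain ⟨x, rfl⟩ := (blockIdx_bijective p q).2 i
    beta_reduce
    rw [Equiv.ofBijective_symm_apply_apply]
    rcases x with x | x
    · rfl
    · refine Fin.cases ?_ (fun j => ?_) x <;> simp
  right_inv K := by
    simp only [Equiv.ofBijective_symm_apply_apply]
    simp

theorem mon_blockExp (p q : ℕ) (z : Fin (p + q + 1) → ℂ) (k : Fin (p + q + 1) → ℤ) :
    mon z k = mon (fun i => z (blockIdx p q (.inl i))) (blockExp p q k).1 *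
      (z (blockIdx p q (.inr 0)) ^ (-(blockExp p q k).2.1 - 1) *
        mon (fun j => z (blockIdx p q (.inr (Fin.succ j)))) (blockExp p q k).2.2) := by
  rw [mon, ← (Equiv.ofBijective _ (blockIdx_bijective p q)).prod_comp, Fintype.prod_sum_type,
    Fin.prod_univ_succ]
  rfl

theorem hasSum_blockCoeff_top (B : Bimod A W) {φ : W →ₗ[ℂ] ℂ} (hφ : InGradedDual B.gr.proj φ)
    (u : ℕ → V) (w : W) (p q : ℕ) :
    ∃ R : RatFn (Fin (p + q + 1)), ∀ z, BlockRegion (⟨p, by omega⟩ : Fin (p + q + 1)) q z →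
      HasSum (fun k => blockCoeff B φ u w (p + q + 1) p q k * mon z k)
        (R.eval (shiftBlock ⟨p, by omega⟩ q z)) := by
  set P : Fin (p + q + 1) := ⟨p, by omega⟩ with hP
  obtain ⟨M, R, hR⟩ := exists_hasSum_ylProd_YsR B hφ (fun i : Fin p => u i)
    (fun j : Fin (q + 1) => u (p + q - j)) w
  set e := blockIdx p q with he
  have he0 : e (.inr 0) = P := rfl
  have heP : ∀ x, x ≠ .inr 0 → e x ≠ P := fun x hx h =>
    hx ((blockIdx_bijective p q).1 (h.trans he0.symm))
  let H : Fin p ⊕ Fin (q + 1) → (Fin (p + q + 1) → ℂ) → ℂ :=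
    fun x z => if x = .inr 0 then -z P else z (e x) - z P
  have hH : ∀ m, IsRat (fun z => (R m).eval (fun x => H x z)) := by
    intro m
    refine IsRat.comp (R m) (fun x => ?_) (fun x => ?_) fun x y hxy => ?_
    · by_cases hx : x = .inr 0
      · simpa only [H, if_pos hx] using (IsRat.coord P).neg
      · simpa only [H, if_neg hx] using (IsRat.coord (e x)).sub (IsRat.coord P)
    · by_cases hx : x = .inr 0
      · simpa only [H, if_pos hx, inv_neg] using (IsRat.inv_coord P).neg
      · simpa only [H, if_neg hx] using IsRat.inv_sub (heP x hx)
    · by_cases hx : x = .inr 0 <;> by_cases hy : y = .inr 0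
      · exact (hxy (hx.trans hy.symm)).elim
      · refine (IsRat.inv_coord (e y)).neg.congr fun z _ _ => ?_
        simp only [H, if_pos hx, if_neg hy, ← inv_neg]
        congr 1
        ring
      · refine (IsRat.inv_coord (e x)).congr fun z _ _ => ?_
        simp only [H, if_pos hy, if_neg hx]
        congr 1
        ring
      · refine (IsRat.inv_sub ((blockIdx_bijective p q).1.ne hxy)).congr fun z _ _ => ?_
        simp only [H, if_neg hy, if_neg hx]
        congr 1
        ring
  obtain ⟨S, hS⟩ := IsRat.sum (Finset.range M) (H := fun m z =>
    (R m).eval (fun x => H x z) * z P ^ m) fun m _ => (hH m).mul ((IsRat.coord P).pow m)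
  refine ⟨S, ?_⟩
  let r : Fin (p + q + 1) → ℝ := fun i =>
    if i < P then 3 * ((p : ℝ) - i) else if i = P then 1 else ((i : ℝ) - p) / (q + 1)
  have hr1 : ∀ i, i < P → r i = 3 * ((p : ℝ) - i) := fun i hi => if_pos hi
  have hr2 : r P = 1 := by simp [r]
  have hr3 : ∀ i, P < i → r i = ((i : ℝ) - p) / (q + 1) := fun i hi => by
    simp only [r]
    rw [if_neg hi.le.not_gt, if_neg hi.ne']
  have hq : (0 : ℝ) < q + 1 := by positivity
  have hs1 : ∀ i, i < P → 3 ≤ r i := fun i hi => by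
    rw [hr1 i hi]
    have : (i : ℝ) + 1 ≤ p := by exact_mod_cast Fin.lt_def.1 hi
    linarith
  have hs3 : ∀ i, P < i → 0 < r i ∧ r i < 1 := fun i hi => by
    rw [hr3 i hi]
    have h1 : (p : ℝ) < i := by exact_mod_cast Fin.lt_def.1 hi
    have h2 : (i : ℝ) < p + q + 1 := by exact_mod_cast i.2
    exact ⟨div_pos (by linarith) hq, by rw [div_lt_one hq]; linarith⟩
  have hs1' : ∀ i j, i < j → j < P → r j + 3 ≤ r i := fun i j hij hj => by
    rw [hr1 i (hij.trans hj), hr1 j hj]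
    have : (i : ℝ) + 1 ≤ j := by exact_mod_cast Fin.lt_def.1 hij
    linarith
  have hs3' : ∀ i j, P < i → i < j → r i < r j := fun i j hi hij => by
    rw [hr3 i hi, hr3 j (hi.trans hij)]
    have : (i : ℝ) < j := by exact_mod_cast Fin.lt_def.1 hij
    gcongr
  have hr : ∀ i, 0 < r i := fun i => by
    rcases lt_trichotomy i P with h | h | h
    · linarith [hs1 i h]
    · rw [h, hr2]
      exact one_pos
    · exact (hs3 i h).1
  have hΩ : ∀ z : Fin (p + q + 1) → ℂ, (∀ i, ‖z i‖ = r i) → BlockRegion P q z := by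
    intro z hz
    have hlast : ∀ j : Fin (p + q + 1), ¬ ((P : ℕ) + q < j) := fun j hj => by
      have := j.2
      simp only [hP] at hj
      omega
    refine ⟨fun i => norm_pos_iff.1 (by rw [hz]; exact hr i), fun i j hij hj => ?_,
      fun i j hi hj => ?_, fun i j _ hj => (hlast j hj).elim, fun i hi => ?_,
      fun i j _ hj => (hlast j hj).elim, fun i j hi hj hij => ?_, fun i j hi => (hlast i hi).elim⟩
    · rw [hz, hz]
      rcases hj.lt_or_eq with h | h
      · linarith [hs1' i j hij h]
      · subst h
        linarith [hs1 i hij]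
    · rw [hz, hz, hz]
      linarith [hs1 i hi, (hs3 j hj.1).2]
    · rw [hz, hz, hr2]
      exact (hs3 i hi.1).2
    · rw [hz, hz]
      exact hs3' i j hi.1 hij
  refine hasSum_of_torus S _ r hr hΩ fun z hz => ?_
  have hB := hΩ z hz
  have hb : ∀ i : Fin (p + q + 1), P < i → InBlock P q i := fun i hi =>
    ⟨hi, by have := i.2; simp only [hP]; omega⟩
  rw [← hS _ hB.shift_ne_zero hB.conf, ← (blockExp p q).symm.hasSum_iff]
  have hlt : ∀ i, e (.inl i) < P := fun i => by
    rw [Fin.lt_def]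
    exact i.2
  have hgt : ∀ j : Fin q, P < e (.inr j.succ) := fun j => by
    rw [Fin.lt_def]
    simp only [he, blockIdx, Sum.elim_inr, Fin.cons_succ, hP]
    omega
  have hPsh : shiftBlock P q z P = z P := shiftBlock_of_notMem (fun h => lt_irrefl _ h.1) z
  have h1 := hR (fun i => z (e (.inl i))) (z P) (fun j => z (e (.inr j.succ))) (hB.ne_zero P)
    (fun j => hB.ne_zero _) (fun i j hij => by
      rw [hz, hz]
      refine hs3' _ _ (hgt j) ?_
      rw [Fin.lt_def] at hij ⊢
      simp only [he, blockIdx, Sum.elim_inr, Fin.cons_succ]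
      omega)
    (fun j => by
      rw [hz, hz, hr2]
      exact (hs3 _ (hgt j)).2)
    (fun i => by
      rw [hz, hz, hr2]
      linarith [hs1 _ (hlt i)])
    (fun i j hij => by
      rw [hz, hz, hz, hr2]
      linarith [hs1' (e (.inl i)) (e (.inl j)) hij (hlt j)])
  have hval : (fun x => H x (shiftBlock P q z)) = Sum.elim (fun i => z (e (.inl i)) - z P)
      (Fin.cons (-z P) fun j => z (e (.inr j.succ))) := by
    funext x
    rcases x with i | j
    · simp only [H, reduceCtorEq, if_false, Sum.elim_inl, hPsh]
      rw [shiftBlock_of_notMem fun h => (hlt i).not_gt h.1]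
    · refine Fin.cases ?_ (fun j => ?_) j
      · simp [H, hPsh]
      · have : (Sum.inr j.succ : Fin p ⊕ Fin (q + 1)) ≠ .inr 0 := by
          simp [Fin.succ_ne_zero]
        simp only [H, if_neg this, hPsh, Sum.elim_inr, Fin.cons_succ]
        rw [shiftBlock_of_mem (hb _ (hgt j))]
        ring
  have hsum : ∑ m ∈ Finset.range M, (R m).eval (fun x => H x (shiftBlock P q z)) *
      shiftBlock P q z P ^ m = ∑ m ∈ Finset.range M, (R m).eval
        (Sum.elim (fun i => z (e (.inl i)) - z P) (Fin.cons (-z P) fun j => z (e (.inr j.succ))))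
          * z P ^ m := by
    simp only [hval, hPsh]
  beta_reduce
  rw [hsum]
  refine h1.congr_fun fun K => ?_
  obtain ⟨k, rfl⟩ := (blockExp p q).surjective K
  simp only [Function.comp_apply, Equiv.symm_apply_apply]
  rw [mon_blockExp, ← mul_assoc (mon _ _)]
  congr 1
  rw [blockCoeff, iterV_eq, Nat.sub_self, ysProd, extZ_of_lt k (show p < p + q + 1 by omega)]
  have h2 : (fun i : Fin p => extZ k i) = (blockExp p q k).1 := by
    funext i
    exact extZ_of_lt k (by omega)
  have h3 : (fun j : Fin q => extZ k (p + q - j)) = (blockExp p q k).2.2 := by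
    funext j
    exact extZ_of_lt k (by omega)
  rw [h2, h3]
  rfl

end BlockCoeff

/-! ### Associativity for the opposite right vertex operator -/

section OppositeAssoc

variable {V : Type*} [AddCommGroup V] [Module ℂ V]
variable {W : Type*} [AddCommGroup W] [Module ℂ W]
variable {A : MOSVA V} (B : Bimod A W)

theorem hasSum_YsR_YsR (ψ : W →ₗ[ℂ] ℂ) (v₁ v₂ : V) (w : W) (k₁ k₂ : ℤ) :
    HasSum (fun x : ℕ × ℕ => (-1 : ℂ) ^ (k₁ + x.1 + 1) * (-1) ^ (k₂ + 1) *
        bc (k₁ + x.1 - x.2) x.2 *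
        ψ (dpow B x.1 (B.YR (B.YR w v₂ (k₂ + x.2)) v₁ (k₁ + x.1 - x.2))))
      (ψ (B.YsR v₁ (B.YsR v₂ w k₂) k₁)) := by
  obtain ⟨N, hN, h1⟩ := exists_YsR_eq_sum B v₂ w k₂
  rw [h1, YsR_sum_smul]
  refine HasSum.prod_range (M := N) (F := fun m j : ℕ => (-1 : ℂ) ^ (k₁ + m + 1) * (-1) ^ (k₂ + 1) *
    bc (k₁ + m - j) j * ψ (dpow B m (B.YR (B.YR w v₂ (k₂ + j)) v₁ (k₁ + m - j))))
    (fun j hj m => by simp [hN j hj]) fun j => ?_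
  refine ((hasSum_YsR B ψ v₁ (dpow B j (B.YR w v₂ (k₂ + j))) k₁).mul_left
    ((-1 : ℂ) ^ (k₂ + j + 1))).congr_fun fun m => ?_
  rw [YR_dpow, map_smul, map_smul, smul_eq_mul]
  have h2 : (-1 : ℂ) ^ (k₂ + j + 1) * (-1) ^ j = (-1) ^ (k₂ + 1) := by
    rw [← zpow_natCast, ← zpow_add₀ (by norm_num), show k₂ + j + 1 + j = k₂ + 1 + 2 * j by ring,
      zpow_add₀ (by norm_num), zpow_mul]
    norm_num
  rw [← h2]
  ring

theorem neg_zpow_mul_pow {t : ℂ} (ht : t ≠ 0) (k : ℤ) (m : ℕ) :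
    (-t) ^ (-(k + m : ℤ) - 1) * t ^ m = (-1) ^ (k + m + 1) * t ^ (-k - 1) := by
  rw [neg_eq_neg_one_mul, mul_zpow, mul_assoc, ← zpow_natCast t m, ← zpow_add₀ ht]
  congr 1
  · rw [show -(k + m : ℤ) - 1 = -(k + m + 1) by ring, zpow_neg, ← inv_zpow]
    norm_num
  · congr 1
    ring

theorem exists_YsR_assoc {ψ : W →ₗ[ℂ] ℂ} (hψ : InGradedDual B.gr.proj ψ) (v₁ v₂ : V) (w : W) :
    ∃ Q : ℂ → ℂ → ℂ,
      (∀ z₁ z₂ : ℂ, 0 < ‖z₂‖ → 2 * ‖z₂‖ < ‖z₁‖ →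
        HasSum (fun k : ℤ × ℤ => ψ (B.YsR v₁ (B.YsR v₂ w k.2) k.1) *
          (z₁ ^ (-k.1 - 1) * z₂ ^ (-k.2 - 1))) (Q z₁ z₂)) ∧
      ∀ z₁ x : ℂ, 0 < ‖x‖ → ‖x‖ < ‖z₁‖ →
        HasSum (fun k : ℤ × ℤ => ψ (B.YsR (A.Y v₂ v₁ k.2) w k.1) *
          (z₁ ^ (-k.1 - 1) * x ^ (-k.2 - 1))) (Q z₁ (z₁ + x)) := by
  obtain ⟨M, hM⟩ := exists_comp_dpow_eq_zero B hψ
  have hM' : ∀ m, M ≤ m → ∀ w, ψ (dpow B m w) = 0 := fun m hm w => by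
    simpa using LinearMap.congr_fun (hM m hm) w
  choose R hR hR' using fun m => B.associativityR w v₂ v₁ (ψ ∘ₗ dpow B m) (hψ.comp_dpow B m)
  refine ⟨fun z₁ z₂ => ∑ m ∈ Finset.range M, (R m).eval ![-z₁, z₂ - z₁] * z₁ ^ m,
    fun z₁ z₂ hz₂ hz => ?_, fun z₁ x hx hz => ?_⟩
  · have h2 : z₂ ≠ 0 := norm_pos_iff.1 hz₂
    have h1 : z₁ ≠ 0 := norm_pos_iff.1 (by linarith)
    have hs : ∀ (m : ℕ) (c : ℝ), ‖z₂‖ < c → Summable fun k : ℤ × ℤ =>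
        ‖ψ (dpow B m (B.YR (B.YR w v₂ k.1) v₁ k.2)) * (-z₂) ^ (-k.1 - 1)‖ * c ^ (-k.2 - 1) := by
      intro m c hc
      have := (hR' m ((c : ℂ) - z₂) c (by
        simpa [abs_of_pos (hz₂.trans hc)] using hc) (by simpa using h2)).1
      refine this.congr fun k => ?_
      simp [norm_zpow, abs_of_pos (hz₂.trans hc)]
    have h3 : ∀ m, HasSum (fun x : (ℤ × ℤ) × ℕ =>
        ψ (dpow B m (B.YR (B.YR w v₂ x.1.1) v₁ x.1.2)) * (-z₂) ^ (-x.1.1 - 1) * bc x.1.2 x.2 *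
          (-z₁) ^ (-x.1.2 - 1 - x.2) * (-z₂) ^ x.2) ((R m).eval ![-z₁, z₂ - z₁]) := by
      intro m
      refine hasSum_reexpand (fun k : ℤ × ℤ => k.2)
        (fun k => ψ (dpow B m (B.YR (B.YR w v₂ k.1) v₁ k.2)) * (-z₂) ^ (-k.1 - 1))
        (by rw [norm_neg, norm_neg]; linarith) ?_ ?_ ?_
      · have h4 : ‖z₁‖ - ‖z₂‖ ≤ ‖z₂ - z₁‖ := by
          rw [norm_sub_rev]
          exact norm_sub_norm_le _ _
        have := (hR' m (-z₁) (z₂ - z₁)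
          (by rw [show -z₁ - (z₂ - z₁) = -z₂ by ring, norm_neg]; linarith)
          (by rw [show -z₁ - (z₂ - z₁) = -z₂ by ring, norm_neg]; exact hz₂)).2
        rw [show -z₁ - (z₂ - z₁) = -z₂ by ring] at this
        rw [show -z₁ - -z₂ = z₂ - z₁ by ring]
        exact this
      · rw [norm_neg, norm_neg]
        exact hs m _ (by linarith)
      · rw [norm_neg, norm_neg]
        exact hs m _ (by linarith)
    have h4 := HasSum.prod_range (M := M) (F := fun (x : (ℤ × ℤ) × ℕ) (m : ℕ) =>
        ψ (dpow B m (B.YR (B.YR w v₂ x.1.1) v₁ x.1.2)) * (-z₂) ^ (-x.1.1 - 1) * bc x.1.2 x.2 *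
          (-z₁) ^ (-x.1.2 - 1 - x.2) * (-z₂) ^ x.2 * z₁ ^ m)
      (fun m hm x => by simp [hM' m hm]) fun m => (h3 m).mul_right (z₁ ^ m)
    let e : (ℤ × ℤ) × (ℕ × ℕ) ≃ ((ℤ × ℤ) × ℕ) × ℕ :=
      { toFun := fun x => (((x.1.2 + x.2.2, x.1.1 + x.2.1 - x.2.2), x.2.2), x.2.1)
        invFun := fun y => ((y.1.1.2 - y.2 + y.1.2, y.1.1.1 - y.1.2), (y.2, y.1.2))
        left_inv := fun x => by
          simp only [Prod.ext_iff, and_true]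
          constructor <;> ring
        right_inv := fun y => by
          simp only [Prod.ext_iff, and_true]
          constructor <;> ring }
    rw [← e.hasSum_iff] at h4
    refine h4.prod_fiberwise fun k => ?_
    refine ((hasSum_YsR_YsR B ψ v₁ v₂ w k.1 k.2).mul_right
      (z₁ ^ (-k.1 - 1) * z₂ ^ (-k.2 - 1))).congr_fun fun x => ?_
    simp only [Function.comp_apply, e, Equiv.coe_fn_mk]
    have h5 := neg_zpow_mul_pow h1 k.1 x.1
    have h6 : (-z₂) ^ (-(k.2 + x.2 : ℤ) - 1) * (-z₂) ^ x.2 =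
        (-1) ^ (k.2 + 1) * z₂ ^ (-k.2 - 1) := by
      rw [← zpow_natCast, ← zpow_add₀ (neg_ne_zero.2 h2)]
      have := neg_zpow_mul_pow h2 k.2 0
      simp only [Nat.cast_zero, add_zero, pow_zero, mul_one] at this
      rw [← this]
      congr 1
      ring
    rw [show -(k.1 + x.1 - x.2 : ℤ) - 1 - x.2 = -(k.1 + x.1) - 1 by ring]
    linear_combination ψ (dpow B x.1 (B.YR (B.YR w v₂ (k.2 + x.2)) v₁ (k.1 + x.1 - x.2))) *
      bc (k.1 + x.1 - x.2) x.2 * ((-z₁) ^ (-(k.1 + x.1) - 1) * z₁ ^ x.1 * h6 +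
        (-1) ^ (k.2 + 1) * z₂ ^ (-k.2 - 1) * h5)
  · have h1 : z₁ ≠ 0 := norm_pos_iff.1 (hx.trans hz)
    have h4 := HasSum.prod_range (M := M) (F := fun (k : ℤ × ℤ) (m : ℕ) =>
        ψ (dpow B m (B.YR w (A.Y v₂ v₁ k.2) k.1)) * (-z₁) ^ (-k.1 - 1) * x ^ (-k.2 - 1) * z₁ ^ m)
      (fun m hm x => by simp [hM' m hm])
      fun m => ((hR m (-z₁) x (by rwa [norm_neg]) hx).2.mul_right (z₁ ^ m))
    let e : (ℤ × ℤ) × ℕ ≃ (ℤ × ℤ) × ℕ :=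
      { toFun := fun x => ((x.1.1 + x.2, x.1.2), x.2)
        invFun := fun x => ((x.1.1 - x.2, x.1.2), x.2)
        left_inv := fun x => by simp
        right_inv := fun x => by simp }
    rw [← e.hasSum_iff] at h4
    beta_reduce
    rw [show z₁ + x - z₁ = x by ring]
    refine h4.prod_fiberwise fun k => ?_
    refine ((hasSum_YsR B ψ (A.Y v₂ v₁ k.2) w k.1).mul_right
      (z₁ ^ (-k.1 - 1) * x ^ (-k.2 - 1))).congr_fun fun m => ?_
    simp only [Function.comp_apply, e, Equiv.coe_fn_mk]
    linear_combination ψ (dpow B m (B.YR w (A.Y v₂ v₁ k.2) (k.1 + m))) * x ^ (-k.2 - 1) *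
      neg_zpow_mul_pow h1 k.1 m

end OppositeAssoc

/-! ### Comparison of Laurent series -/

section Compare

theorem zpow_le_add {r₁ r₂ t : ℝ} (h0 : 0 < r₁) (h1 : r₁ ≤ t) (h2 : t ≤ r₂) (k : ℤ) :
    t ^ k ≤ r₁ ^ k + r₂ ^ k := by
  have ht := h0.trans_le h1
  rcases le_total 0 k with hk | hk
  · have := zpow_le_zpow_left₀ hk ht.le h2
    have := zpow_pos h0 k
    linarith
  · obtain ⟨m, rfl⟩ := Int.exists_eq_neg_ofNat hk
    simp only [zpow_neg, zpow_natCast]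
    have h3 : (t ^ m)⁻¹ ≤ (r₁ ^ m)⁻¹ := by gcongr
    have := pow_pos (ht.trans_le h2) m
    have : 0 < (r₂ ^ m)⁻¹ := by positivity
    linarith

/-- A Laurent series which converges on a punctured disc and vanishes on a small disc has vanishing
coefficients. -/
theorem laurent_eq_zero_of_disc (a : ℤ → ℂ)
    (hs : ∀ t : ℂ, 0 < ‖t‖ → ‖t‖ < 1 / 2 → Summable fun k => a k * t ^ (-k - 1))
    (h0 : ∀ t ∈ Metric.ball (1 / 4 : ℂ) (1 / 8), HasSum (fun k => a k * t ^ (-k - 1)) 0) :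
    a = 0 := by
  let U : Set ℂ := {s | Real.log (1 / 8) < s.re} ∩ {s | s.re < Real.log (3 / 8)}
  let G : ℂ → ℂ := fun s => ∑' k, a k * Complex.exp s ^ (-k - 1)
  have hUo : IsOpen U := (isOpen_lt continuous_const Complex.continuous_re).inter
    (isOpen_lt Complex.continuous_re continuous_const)
  have hUc : IsPreconnected U :=
    ((convex_halfSpace_re_gt _).inter (convex_halfSpace_re_lt _)).isPreconnected
  have hU : ∀ s ∈ U, 1 / 8 < ‖Complex.exp s‖ ∧ ‖Complex.exp s‖ < 3 / 8 := by
    intro s hs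
    rw [Complex.norm_exp]
    exact ⟨(Real.log_lt_iff_lt_exp (by norm_num)).1 hs.1,
      (Real.lt_log_iff_exp_lt (by norm_num)).1 hs.2⟩
  have hsum : Summable fun k : ℤ => ‖a k‖ * ((1 / 8 : ℝ) ^ (-k - 1) + (3 / 8 : ℝ) ^ (-k - 1)) := by
    have h1 := (hs (1 / 8) (by norm_num) (by norm_num)).norm
    have h2 := (hs (3 / 8) (by norm_num) (by norm_num)).norm
    refine (h1.add h2).congr fun k => ?_
    rw [norm_mul, norm_mul, norm_zpow, norm_zpow, mul_add]
    norm_num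
  have hG : DifferentiableOn ℂ G U := by
    refine Complex.differentiableOn_tsum_of_summable_norm hsum (fun k => ?_) hUo fun k s hs => ?_
    · intro s _
      refine DifferentiableAt.differentiableWithinAt ?_
      exact (Complex.differentiable_exp s).zpow (.inl (Complex.exp_ne_zero s)) |>.const_mul (a k)
    · rw [norm_mul, norm_zpow]
      exact mul_le_mul_of_nonneg_left
        (zpow_le_add (by norm_num) (hU s hs).1.le (hU s hs).2.le _) (norm_nonneg _)
  have hz0 : ((Real.log (1 / 4) : ℝ) : ℂ) ∈ U := by
    constructor
    · exact Real.log_lt_log (by norm_num) (by norm_num)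
    · exact Real.log_lt_log (by norm_num) (by norm_num)
  have hexp : Complex.exp ((Real.log (1 / 4) : ℝ) : ℂ) = 1 / 4 := by
    rw [← Complex.ofReal_exp, Real.exp_log (by norm_num)]
    norm_num
  have hE := (hG.analyticOnNhd hUo).eqOn_zero_of_preconnected_of_eventuallyEq_zero hUc hz0 (by
    have hc := Complex.continuous_exp.continuousAt (x := ((Real.log (1 / 4) : ℝ) : ℂ))
    rw [ContinuousAt, hexp] at hc
    filter_upwards [hc (Metric.ball_mem_nhds _ (by norm_num : (0 : ℝ) < 1 / 8))] with s hs
    exact (h0 _ hs).tsum_eq)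
  refine laurent_unique_one (1 / 4) (by norm_num) a fun t ht => ?_
  have ht0 : t ≠ 0 := norm_pos_iff.1 (by rw [ht]; norm_num)
  have h1 := (hs t (by rw [ht]; norm_num) (by rw [ht]; norm_num)).hasSum
  have h2 := hE (x := Complex.log t) (by
    refine ⟨?_, ?_⟩
    · simp only [Set.mem_ofPred_eq, Complex.log_re, ht]
      exact Real.log_lt_log (by norm_num) (by norm_num)
    · simp only [Set.mem_ofPred_eq, Complex.log_re, ht]
      exact Real.log_lt_log (by norm_num) (by norm_num))
  simp only [G, Complex.exp_log ht0, Pi.zero_apply] at h2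
  rwa [h2] at h1

theorem laurent_eq_zero_of_cone (d : ℤ × ℤ → ℂ)
    (hs : ∀ z₁ z₂ : ℂ, ‖z₁‖ = 1 → 0 < ‖z₂‖ → ‖z₂‖ < 1 / 2 →
      Summable fun k => d k * (z₁ ^ (-k.1 - 1) * z₂ ^ (-k.2 - 1)))
    (h0 : ∀ z₁ z₂ : ℂ, ‖z₁‖ = 1 → 0 < ‖z₂‖ → ‖z₂‖ < 1 / 2 → 5 / 8 < ‖z₂ - z₁‖ →
      ‖z₂ - z₁‖ < 7 / 8 → HasSum (fun k => d k * (z₁ ^ (-k.1 - 1) * z₂ ^ (-k.2 - 1))) 0) :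
    d = 0 := by
  let e : ℤ × ℤ ≃ ℤ × ℤ :=
    { toFun := fun x => (x.1 - 1 - x.2, x.2)
      invFun := fun x => (x.1 + 1 + x.2, x.2)
      left_inv := fun x => Prod.ext (by ring) rfl
      right_inv := fun x => Prod.ext (by ring) rfl }
  have he : ∀ (z t : ℂ) (x : ℤ × ℤ), z ≠ 0 →
      d (e x) * (z ^ (-(e x).1 - 1) * (z * t) ^ (-(e x).2 - 1)) =
        d (e x) * t ^ (-x.2 - 1) * z ^ (-x.1 - 1) := by
    intro z t x hz
    rw [mul_zpow, ← mul_assoc (z ^ _), ← zpow_add₀ hz]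
    simp only [e, Equiv.coe_fn_mk]
    rw [show -(x.1 - 1 - x.2) - 1 + (-x.2 - 1) = -x.1 - 1 by ring]
    ring
  have hs' : ∀ t : ℂ, 0 < ‖t‖ → ‖t‖ < 1 / 2 → ∀ N : ℤ,
      Summable fun b => d (e (N, b)) * t ^ (-b - 1) := by
    intro t ht ht' N
    have h1 := hs 1 t (by simp) ht ht'
    rw [← e.summable_iff] at h1
    refine (h1.prod_factor N).congr fun b => ?_
    have := he 1 t (N, b) one_ne_zero
    simp only [one_mul, one_zpow, mul_one] at this
    simpa only [Function.comp_apply, one_zpow, one_mul] using this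
  have h2 : ∀ N : ℤ, (fun b => d (e (N, b))) = 0 := by
    intro N
    refine laurent_eq_zero_of_disc _ (fun t ht ht' => hs' t ht ht' N) fun t ht => ?_
    rw [mem_ball_iff_norm] at ht
    have e1 : ‖(1 / 4 : ℂ)‖ = 1 / 4 := by norm_num
    have e2 : ‖(3 / 4 : ℂ)‖ = 3 / 4 := by norm_num
    have ht1 : 1 / 8 < ‖t‖ := by
      have := norm_sub_norm_le (1 / 4 : ℂ) t
      rw [norm_sub_rev] at this
      linarith
    have ht2 : ‖t‖ < 1 / 2 := by
      have := norm_sub_norm_le t (1 / 4 : ℂ)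
      linarith
    have ht3 : 5 / 8 < ‖t - 1‖ := by
      have := norm_sub_norm_le (3 / 4 : ℂ) (t - 1 / 4)
      rw [norm_sub_rev (3 / 4 : ℂ), show t - 1 / 4 - 3 / 4 = t - 1 by ring] at this
      linarith
    have ht4 : ‖t - 1‖ < 7 / 8 := by
      have := norm_sub_le (t - 1 / 4) (3 / 4 : ℂ)
      rw [show t - 1 / 4 - 3 / 4 = t - 1 by ring] at this
      linarith
    have h3 := laurent_unique_one 1 one_pos (fun N => ∑' b, d (e (N, b)) * t ^ (-b - 1))
      fun z hz => by
        have hz0 : z ≠ 0 := norm_pos_iff.1 (by rw [hz]; norm_num)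
        have h4 := h0 z (z * t) hz (by rw [norm_mul, hz]; linarith)
          (by rw [norm_mul, hz]; linarith)
          (by rw [show z * t - z = z * (t - 1) by ring, norm_mul, hz]; linarith)
          (by rw [show z * t - z = z * (t - 1) by ring, norm_mul, hz]; linarith)
        rw [← e.hasSum_iff] at h4
        refine h4.prod_fiberwise fun N => ?_
        refine ((hs' t (by linarith) ht2 N).hasSum.mul_right (z ^ (-N - 1))).congr_fun fun b => ?_
        exact he z t (N, b) hz0
    have h5 := (hs' t (by linarith) ht2 N).hasSum
    rwa [congrFun h3 N] at h5
  funext k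
  obtain ⟨x, rfl⟩ := e.surjective k
  exact congrFun (h2 x.1) x.2

variable {κ : Type*} [Fintype κ]

/-- Two Laurent series `h`, `h'` coincide if, after re-expansion, both are related to a third
Laurent series `g`: one slice by slice in the variables indexed by `κ`, the other globally. -/
theorem laurent_eq_of_slices (h h' g : ℤ × ℤ → (κ → ℤ) → ℂ) (F : ℂ → ℂ → (κ → ℂ) → ℂ)
    (r : ℝ → κ → ℝ) (hr : ∀ t, 0 < t → ∀ i, 0 < r t i)
    (hh' : ∀ z₁ z₂ y, ‖z₁‖ = 1 → 0 < ‖z₂‖ → ‖z₂‖ < 1 / 2 → (∀ i, ‖y i‖ = r ‖z₂‖ i) →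
      HasSum (fun x : (ℤ × ℤ) × (κ → ℤ) =>
        h' x.1 x.2 * (z₁ ^ (-x.1.1 - 1) * z₂ ^ (-x.1.2 - 1) * mon y x.2)) (F z₁ z₂ y))
    (hg : ∀ z₁ z₂ y, ‖z₁‖ = 1 → 0 < ‖z₂‖ → ‖z₂‖ < 1 / 2 → 5 / 8 < ‖z₂ - z₁‖ →
      ‖z₂ - z₁‖ < 7 / 8 → (∀ i, ‖y i‖ = r ‖z₂‖ i) →
      HasSum (fun x : (ℤ × ℤ) × (κ → ℤ) =>
        g x.1 x.2 * (z₁ ^ (-x.1.1 - 1) * (z₂ - z₁) ^ (-x.1.2 - 1) * mon y x.2)) (F z₁ z₂ y))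
    (hQ : ∀ K, ∃ Q : ℂ → ℂ → ℂ,
      (∀ z₁ z₂ : ℂ, 0 < ‖z₂‖ → 2 * ‖z₂‖ < ‖z₁‖ → HasSum (fun k : ℤ × ℤ =>
        h k K * (z₁ ^ (-k.1 - 1) * z₂ ^ (-k.2 - 1))) (Q z₁ z₂)) ∧
      ∀ z₁ x : ℂ, 0 < ‖x‖ → ‖x‖ < ‖z₁‖ → HasSum (fun k : ℤ × ℤ =>
        g k K * (z₁ ^ (-k.1 - 1) * x ^ (-k.2 - 1))) (Q z₁ (z₁ + x))) :
    h = h' := by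
  have hρ : ∀ t, 0 < t → ∃ y : κ → ℂ, (∀ i, ‖y i‖ = r t i) ∧ ∀ i, y i ≠ 0 := fun t ht =>
    ⟨fun i => r t i, fun i => by simp [abs_of_pos (hr t ht i)],
      fun i => by simpa using (hr t ht i).ne'⟩
  have hs' : ∀ z₁ z₂ : ℂ, ‖z₁‖ = 1 → 0 < ‖z₂‖ → ‖z₂‖ < 1 / 2 → ∀ K,
      Summable fun k : ℤ × ℤ => h' k K * (z₁ ^ (-k.1 - 1) * z₂ ^ (-k.2 - 1)) := by
    intro z₁ z₂ h1 h2 h3 K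
    obtain ⟨y, hy, hy0⟩ := hρ _ h2
    have h4 := (hh' z₁ z₂ y h1 h2 h3 hy).summable.prod_symm.prod_factor K
    rw [← summable_mul_right_iff (mon_ne_zero hy0 K)]
    refine h4.congr fun k => ?_
    simp only [Prod.swap]
    ring
  have hd : ∀ K, (fun k => h k K - h' k K) = 0 := by
    intro K
    obtain ⟨Q, hQ1, hQ2⟩ := hQ K
    refine laurent_eq_zero_of_cone _ (fun z₁ z₂ h1 h2 h3 => ?_) fun z₁ z₂ h1 h2 h3 h4 h5 => ?_
    · refine ((hQ1 z₁ z₂ h2 (by linarith)).summable.sub (hs' z₁ z₂ h1 h2 h3 K)).congr fun k => ?_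
      rw [sub_mul]
    · have hgs : ∀ K', Summable fun k : ℤ × ℤ =>
          g k K' * (z₁ ^ (-k.1 - 1) * (z₂ - z₁) ^ (-k.2 - 1)) := fun K' => by
        obtain ⟨_, _, h6⟩ := hQ K'
        exact (h6 z₁ (z₂ - z₁) (by linarith) (by linarith)).summable
      have hu := laurent_unique (r ‖z₂‖) (hr _ h2)
        (fun K => (∑' k : ℤ × ℤ, h' k K * (z₁ ^ (-k.1 - 1) * z₂ ^ (-k.2 - 1))) -
          ∑' k : ℤ × ℤ, g k K * (z₁ ^ (-k.1 - 1) * (z₂ - z₁) ^ (-k.2 - 1))) fun y hy => by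
        have h6 : HasSum (fun K => (∑' k : ℤ × ℤ,
            h' k K * (z₁ ^ (-k.1 - 1) * z₂ ^ (-k.2 - 1))) * mon y K) (F z₁ z₂ y) := by
          have h7 := hh' z₁ z₂ y h1 h2 h3 hy
          rw [← (Equiv.prodComm _ _).hasSum_iff] at h7
          refine h7.prod_fiberwise fun K => ?_
          refine ((hs' z₁ z₂ h1 h2 h3 K).hasSum.mul_right (mon y K)).congr_fun fun k => ?_
          simp only [Function.comp_apply, Equiv.prodComm_apply, Prod.swap]
          ring
        have h8 : HasSum (fun K => (∑' k : ℤ × ℤ,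
            g k K * (z₁ ^ (-k.1 - 1) * (z₂ - z₁) ^ (-k.2 - 1))) * mon y K) (F z₁ z₂ y) := by
          have h7 := hg z₁ z₂ y h1 h2 h3 h4 h5 hy
          rw [← (Equiv.prodComm _ _).hasSum_iff] at h7
          refine h7.prod_fiberwise fun K => ?_
          refine ((hgs K).hasSum.mul_right (mon y K)).congr_fun fun k => ?_
          simp only [Function.comp_apply, Equiv.prodComm_apply, Prod.swap]
          ring
        have h9 := h6.sub h8
        rw [sub_self] at h9
        exact h9.congr_fun fun K => by rw [sub_mul]
      have h10 := (hQ2 z₁ (z₂ - z₁) (by linarith) (by linarith)).tsum_eq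
      rw [add_sub_cancel] at h10
      have h11 := (hQ1 z₁ z₂ h2 (by linarith)).sub (hs' z₁ z₂ h1 h2 h3 K).hasSum
      rw [sub_eq_zero.1 (congrFun hu K), h10, sub_self] at h11
      exact h11.congr_fun fun k => by rw [sub_mul]
  funext k K
  exact sub_eq_zero.1 (congrFun (hd K) k)

end Compare

/-! ### Splitting off two variables -/

section Glue

variable {ι : Type*} [DecidableEq ι] {α : Type*} {i₀ i₁ : ι}

/-- The family with prescribed values at `i₀`, at `i₁` and at the other indices. -/
def glue (i₀ i₁ : ι) (a b : α) (y : {i // i ≠ i₀ ∧ i ≠ i₁} → α) (i : ι) : α :=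
  if h₀ : i = i₀ then a else if h₁ : i = i₁ then b else y ⟨i, h₀, h₁⟩

theorem glue_left (a b : α) (y : {i // i ≠ i₀ ∧ i ≠ i₁} → α) : glue i₀ i₁ a b y i₀ = a :=
  dif_pos rfl

theorem glue_right (h : i₀ ≠ i₁) (a b : α) (y : {i // i ≠ i₀ ∧ i ≠ i₁} → α) :
    glue i₀ i₁ a b y i₁ = b := by
  rw [glue, dif_neg h.symm, dif_pos rfl]

theorem glue_of_ne (a b : α) (y : {i // i ≠ i₀ ∧ i ≠ i₁} → α) {i : ι} (h : i ≠ i₀ ∧ i ≠ i₁) :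
    glue i₀ i₁ a b y i = y ⟨i, h⟩ := by
  rw [glue, dif_neg h.1, dif_neg h.2]

/-- Families indexed by `ι` correspond to triples as in `glue`. -/
def glueEquiv (h : i₀ ≠ i₁) : (α × α) × ({i // i ≠ i₀ ∧ i ≠ i₁} → α) ≃ (ι → α) where
  toFun x := glue i₀ i₁ x.1.1 x.1.2 x.2
  invFun k := ((k i₀, k i₁), fun i => k i)
  left_inv x := by
    simp only [glue_left, glue_right h]
    congr 1
    funext i
    exact glue_of_ne _ _ _ i.2
  right_inv k := by
    funext i
    simp only [glue]
    split_ifs with h₀ h₁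
    · rw [h₀]
    · rw [h₁]
    · rfl

theorem mon_glue [Fintype ι] (h : i₀ ≠ i₁) (z₁ z₂ : ℂ) (y : {i // i ≠ i₀ ∧ i ≠ i₁} → ℂ)
    (k₁ k₂ : ℤ) (K : {i // i ≠ i₀ ∧ i ≠ i₁} → ℤ) :
    mon (glue i₀ i₁ z₁ z₂ y) (glue i₀ i₁ k₁ k₂ K) =
      z₁ ^ (-k₁ - 1) * z₂ ^ (-k₂ - 1) * mon y K := by
  rw [mon, ← Finset.mul_prod_erase _ _ (Finset.mem_univ i₀),
    ← Finset.mul_prod_erase _ _ (Finset.mem_erase.2 ⟨h.symm, Finset.mem_univ i₁⟩),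
    Finset.prod_subtype (p := fun i => i ≠ i₀ ∧ i ≠ i₁) _ (by simp [and_comm])]
  simp only [glue_left, glue_right h, mon, mul_assoc]
  congr 2
  refine Finset.prod_congr rfl fun i _ => ?_
  rw [glue_of_ne _ _ _ i.2, glue_of_ne _ _ _ i.2]

end Glue

/-! ### Shrinking the block -/

section Step

variable {V : Type*} [AddCommGroup V] [Module ℂ V]
variable {W : Type*} [AddCommGroup W] [Module ℂ W]
variable {A : MOSVA V} (B : Bimod A W)

theorem iterV_congr (u : ℕ → V) {k k' : ℕ → ℤ} (p q : ℕ)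
    (h : ∀ i, p < i → i ≤ p + q → k i = k' i) : iterV A u k p q = iterV A u k' p q := by
  induction q with
  | zero => rfl
  | succ q ih =>
    rw [iterV, iterV, ih fun i h1 h2 => h i h1 (by omega), h _ (by omega) (by omega)]

theorem ysProd_congr (u : ℕ → V) {k k' : ℕ → ℤ} (i c : ℕ) (w : W)
    (h : ∀ j, i ≤ j → k j = k' j) : ysProd B u k i c w = ysProd B u k' i c w := by
  induction c generalizing i with
  | zero => rfl
  | succ c ih => rw [ysProd, ysProd, ih _ fun j hj => h j (by omega), h i le_rfl]

/-- The absolute values of the coordinates other than `p` and `p + q + 1` on the tori used to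
compare the expansions. -/
def torusRadius (n p q : ℕ) (t : ℝ) (i : ℕ) : ℝ :=
  if i < p then 3 * ((p : ℝ) - i) else
    if i ≤ p + q then t * (((i : ℝ) - p) / (16 * n)) else t * (((n : ℝ) - i) / (16 * n))

section Radius

variable {n p q : ℕ} {t : ℝ}

theorem torusRadius_left {i : ℕ} (h : i < p) : torusRadius n p q t i = 3 * ((p : ℝ) - i) :=
  if_pos h

theorem torusRadius_block {i : ℕ} (h : p < i) (h' : i ≤ p + q) :
    torusRadius n p q t i = t * (((i : ℝ) - p) / (16 * n)) := by
  rw [torusRadius, if_neg h.not_gt, if_pos h']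

theorem torusRadius_right {i : ℕ} (h : p + q < i) :
    torusRadius n p q t i = t * (((n : ℝ) - i) / (16 * n)) := by
  rw [torusRadius, if_neg (by omega), if_neg (by omega)]

theorem three_le_torusRadius {i : ℕ} (h : i < p) : 3 ≤ torusRadius n p q t i := by
  rw [torusRadius_left h]
  have : (i : ℝ) + 1 ≤ p := by exact_mod_cast h
  linarith

theorem torusRadius_pos (ht : 0 < t) {i : ℕ} (hi : i < n) (h : i ≠ p) :
    0 < torusRadius n p q t i := by
  have hn : (0 : ℝ) < n := by exact_mod_cast (by omega : 0 < n)
  rcases h.lt_or_gt with h | h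
  · linarith [three_le_torusRadius (n := n) (q := q) (t := t) h]
  · have h1 : (i : ℝ) < n := by exact_mod_cast hi
    have h2 : (p : ℝ) < i := by exact_mod_cast h
    have h3 : (0 : ℝ) < i - p := by linarith
    have h4 : (0 : ℝ) < n - i := by linarith
    by_cases hq : i ≤ p + q
    · rw [torusRadius_block h hq]
      positivity
    · rw [torusRadius_right (not_le.1 hq)]
      positivity

theorem torusRadius_le (ht : 0 < t) {i : ℕ} (hi : i < n) (h : p < i) :
    torusRadius n p q t i ≤ t / 16 := by
  have hn : (0 : ℝ) < n := by exact_mod_cast (by omega : 0 < n)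
  have h1 : (i : ℝ) < n := by exact_mod_cast hi
  have h5 : (0 : ℝ) ≤ p := by positivity
  have h6 : (0 : ℝ) ≤ i := by positivity
  have key : ∀ x : ℝ, x ≤ n → t * (x / (16 * n)) ≤ t / 16 := fun x hx => by
    rw [div_eq_mul_one_div t 16]
    refine mul_le_mul_of_nonneg_left ?_ ht.le
    rw [div_le_div_iff₀ (by positivity) (by norm_num)]
    linarith
  by_cases hq : i ≤ p + q
  · rw [torusRadius_block h hq]
    exact key _ (by linarith)
  · rw [torusRadius_right (not_le.1 hq)]
    exact key _ (by linarith)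

theorem torusRadius_lt_left {i j : ℕ} (hij : i < j) (hj : j < p) :
    torusRadius n p q t j < torusRadius n p q t i := by
  rw [torusRadius_left hj, torusRadius_left (hij.trans hj)]
  have : (i : ℝ) < j := by exact_mod_cast hij
  linarith

theorem torusRadius_lt_block (hn : 0 < n) (ht : 0 < t) {i j : ℕ} (hi : p < i) (hij : i < j)
    (hj : j ≤ p + q) : torusRadius n p q t i < torusRadius n p q t j := by
  rw [torusRadius_block hi (by omega), torusRadius_block (hi.trans hij) hj]
  have : (i : ℝ) < j := by exact_mod_cast hij
  have hn' : (0 : ℝ) < n := by exact_mod_cast hn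
  gcongr

theorem torusRadius_lt_right (hn : 0 < n) (ht : 0 < t) {i j : ℕ} (hi : p + q < i) (hij : i < j) :
    torusRadius n p q t j < torusRadius n p q t i := by
  rw [torusRadius_right hi, torusRadius_right (hi.trans hij)]
  have : (i : ℝ) < j := by exact_mod_cast hij
  have hn' : (0 : ℝ) < n := by exact_mod_cast hn
  gcongr

end Radius

section Regions

variable {n p q : ℕ} {t : ℝ} {z : Fin n → ℂ}

theorem blockRegion_of_torus (hpq : p + q + 1 < n) (ht : 0 < t) (ht' : t < 1 / 2)
    (h0 : ‖z ⟨p, by omega⟩‖ = 1) (h1 : ‖z ⟨p + q + 1, hpq⟩‖ = t)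
    (hz : ∀ i : Fin n, (i : ℕ) ≠ p → (i : ℕ) ≠ p + q + 1 → ‖z i‖ = torusRadius n p q t i) :
    BlockRegion ⟨p, by omega⟩ q z := by
  have hn : 0 < n := by omega
  have hL : ∀ i : Fin n, (i : ℕ) < p → 3 ≤ ‖z i‖ := fun i hi => by
    rw [hz i (by omega) (by omega)]
    exact three_le_torusRadius hi
  have hS : ∀ i : Fin n, p < i → (i : ℕ) ≠ p + q + 1 → ‖z i‖ ≤ t / 16 := fun i hi hi' => by
    rw [hz i (by omega) hi']
    exact torusRadius_le ht i.2 hi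
  have h0' : ∀ i : Fin n, (i : ℕ) = p → ‖z i‖ = 1 := fun i hi => by
    rw [show i = ⟨p, by omega⟩ from Fin.ext hi]
    exact h0
  have h1' : ∀ i : Fin n, (i : ℕ) = p + q + 1 → ‖z i‖ = t := fun i hi => by
    obtain rfl : i = ⟨p + q + 1, hpq⟩ := Fin.ext hi
    exact h1
  have hT : ∀ i : Fin n, p < i → ‖z i‖ ≤ t := fun i hi => by
    by_cases hi' : (i : ℕ) = p + q + 1
    · exact (h1' i hi').le
    · linarith [hS i hi hi']
  refine ⟨fun i => norm_pos_iff.1 ?_, fun i j hij hj => ?_, fun i j hi hj => ?_,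
    fun i j hi hj => ?_, fun i hi => ?_, fun i j hi hj => ?_, fun i j hi hj hij => ?_,
    fun i j hi hij => ?_⟩
  all_goals try simp only [InBlock, Fin.lt_def, Fin.le_def] at *
  · by_cases hi : (i : ℕ) = p
    · rw [h0' i hi]
      exact one_pos
    · by_cases hi' : (i : ℕ) = p + q + 1
      · rwa [h1' i hi']
      · rw [hz i hi hi']
        exact torusRadius_pos ht i.2 hi
  · rcases hj.lt_or_eq with h | h
    · rw [hz j (by omega) (by omega), hz i (by omega) (by omega)]
      exact torusRadius_lt_left hij h
    · rw [h0' j h]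
      linarith [hL i (by omega)]
  · rw [h0]
    linarith [hL i hi, hT j hj.1]
  · have := hT j (by omega)
    rcases hi.lt_or_eq with h | h
    · linarith [hL i h]
    · rw [h0' i h]
      linarith
  · rw [h0]
    linarith [hT i hi.1]
  · rw [h0]
    linarith [hS i hi.1 (by omega), hT j (by omega)]
  · rw [hz i (by omega) (by omega), hz j (by omega) (by omega)]
    exact torusRadius_lt_block hn ht hi.1 hij hj.2
  · by_cases hi' : (i : ℕ) = p + q + 1
    · rw [h1' i hi']
      linarith [hS j (by omega) (by omega)]
    · rw [hz i (by omega) (by omega), hz j (by omega) (by omega)]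
      exact torusRadius_lt_right hn ht hi hij

theorem blockRegion_succ_of_torus (hpq : p + q + 1 < n) (ht : 0 < t) (ht' : t < 1 / 2)
    (h0 : ‖z ⟨p, by omega⟩‖ = 1) (h1 : 5 / 8 < ‖z ⟨p + q + 1, hpq⟩‖)
    (h2 : ‖z ⟨p + q + 1, hpq⟩‖ < 7 / 8)
    (hz : ∀ i : Fin n, (i : ℕ) ≠ p → (i : ℕ) ≠ p + q + 1 → ‖z i‖ = torusRadius n p q t i) :
    BlockRegion ⟨p, by omega⟩ (q + 1) z := by
  have hn : 0 < n := by omega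
  have hL : ∀ i : Fin n, (i : ℕ) < p → 3 ≤ ‖z i‖ := fun i hi => by
    rw [hz i (by omega) (by omega)]
    exact three_le_torusRadius hi
  have hS : ∀ i : Fin n, p < i → (i : ℕ) ≠ p + q + 1 → ‖z i‖ ≤ t / 16 := fun i hi hi' => by
    rw [hz i (by omega) hi']
    exact torusRadius_le ht i.2 hi
  have h0' : ∀ i : Fin n, (i : ℕ) = p → ‖z i‖ = 1 := fun i hi => by
    rw [show i = ⟨p, by omega⟩ from Fin.ext hi]
    exact h0
  have h1' : ∀ i : Fin n, (i : ℕ) = p + q + 1 → 5 / 8 < ‖z i‖ ∧ ‖z i‖ < 7 / 8 := fun i hi => by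
    obtain rfl : i = ⟨p + q + 1, hpq⟩ := Fin.ext hi
    exact ⟨h1, h2⟩
  have hT : ∀ i : Fin n, p < i → ‖z i‖ < 7 / 8 := fun i hi => by
    by_cases hi' : (i : ℕ) = p + q + 1
    · exact (h1' i hi').2
    · linarith [hS i hi hi']
  refine ⟨fun i => norm_pos_iff.1 ?_, fun i j hij hj => ?_, fun i j hi hj => ?_,
    fun i j hi hj => ?_, fun i hi => ?_, fun i j hi hj => ?_, fun i j hi hj hij => ?_,
    fun i j hi hij => ?_⟩
  all_goals try simp only [InBlock, Fin.lt_def, Fin.le_def] at *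
  · by_cases hi : (i : ℕ) = p
    · rw [h0' i hi]
      exact one_pos
    · by_cases hi' : (i : ℕ) = p + q + 1
      · linarith [(h1' i hi').1]
      · rw [hz i hi hi']
        exact torusRadius_pos ht i.2 hi
  · rcases hj.lt_or_eq with h | h
    · rw [hz j (by omega) (by omega), hz i (by omega) (by omega)]
      exact torusRadius_lt_left hij h
    · rw [h0' j h]
      linarith [hL i (by omega)]
  · rw [h0]
    linarith [hL i hi, hT j hj.1]
  · have := hT j (by omega)
    rcases hi.lt_or_eq with h | h
    · linarith [hL i h]
    · rw [h0' i h]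
      linarith
  · rw [h0]
    linarith [hT i hi.1]
  · rw [h0]
    linarith [hT i hi.1, hS j (by omega) (by omega)]
  · by_cases hj' : (j : ℕ) = p + q + 1
    · linarith [hS i hi.1 (by omega), (h1' j hj').1]
    · rw [hz i (by omega) (by omega), hz j (by omega) (by omega)]
      exact torusRadius_lt_block hn ht hi.1 hij (by omega)
  · rw [hz i (by omega) (by omega), hz j (by omega) (by omega)]
    exact torusRadius_lt_right hn ht (by omega) hij

end Regions

theorem shiftBlock_succ_glue {n p q : ℕ} (hpq : p + q + 1 < n) (z₁ z₂ : ℂ)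
    (y : {i : Fin n // i ≠ ⟨p, by omega⟩ ∧ i ≠ ⟨p + q + 1, hpq⟩} → ℂ) :
    shiftBlock ⟨p, by omega⟩ (q + 1) (glue ⟨p, by omega⟩ ⟨p + q + 1, hpq⟩ z₁ (z₂ - z₁) y) =
      shiftBlock ⟨p, by omega⟩ q (glue ⟨p, by omega⟩ ⟨p + q + 1, hpq⟩ z₁ z₂ y) := by
  have hne : (⟨p, by omega⟩ : Fin n) ≠ ⟨p + q + 1, hpq⟩ := by simp; omega
  funext i
  by_cases h1 : i = ⟨p + q + 1, hpq⟩
  · subst h1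
    rw [shiftBlock_of_mem ⟨by simp [Fin.lt_def, add_assoc], by simp [add_assoc]⟩,
      shiftBlock_of_notMem fun h => by have := h.2; simp at this]
    rw [glue_left, glue_right hne, glue_right hne]
    ring
  · have h2 : InBlock ⟨p, by omega⟩ (q + 1) i ↔ InBlock ⟨p, by omega⟩ q i := by
      have h3 : (i : ℕ) ≠ p + q + 1 := fun h => h1 (Fin.ext h)
      simp only [InBlock, Fin.lt_def]
      omega
    have h4 : glue (⟨p, by omega⟩ : Fin n) _ z₁ (z₂ - z₁) y i = glue _ _ z₁ z₂ y i := by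
      simp only [glue, dif_neg h1]
    by_cases h : InBlock ⟨p, by omega⟩ q i
    · rw [shiftBlock_of_mem h, shiftBlock_of_mem (h2.2 h), glue_left, glue_left, h4]
    · rw [shiftBlock_of_notMem h, shiftBlock_of_notMem fun h5 => h (h2.1 h5), h4]

/-- If the series with an iterated block of length `q + 1` expands a rational function, then so
does the series with an iterated block of length `q`. -/
theorem hasSum_blockCoeff_of_succ {φ : W →ₗ[ℂ] ℂ} (hφ : InGradedDual B.gr.proj φ)
    (u : ℕ → V) (w : W) {n p q : ℕ} (hpq : p + q + 1 < n) (R : RatFn (Fin n))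
    (h : ∀ z, BlockRegion (⟨p, by omega⟩ : Fin n) (q + 1) z →
      HasSum (fun k => blockCoeff B φ u w n p (q + 1) k * mon z k)
        (R.eval (shiftBlock ⟨p, by omega⟩ (q + 1) z))) :
    ∀ z, BlockRegion (⟨p, by omega⟩ : Fin n) q z →
      HasSum (fun k => blockCoeff B φ u w n p q k * mon z k)
        (R.eval (shiftBlock ⟨p, by omega⟩ q z)) := by
  obtain ⟨f, hf⟩ := expandable_ratFn ⟨p, by omega⟩ q R
  set P : Fin n := ⟨p, by omega⟩ with hP
  set S : Fin n := ⟨p + q + 1, hpq⟩ with hS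
  have hne : P ≠ S := by simp [hP, hS]; omega
  have hnorm : ∀ (z₁ z₂ : ℂ) (t : ℝ) (y : {i : Fin n // i ≠ P ∧ i ≠ S} → ℂ),
      (∀ i, ‖y i‖ = torusRadius n p q t i) → ∀ i : Fin n, (i : ℕ) ≠ p → (i : ℕ) ≠ p + q + 1 →
        ‖glue P S z₁ z₂ y i‖ = torusRadius n p q t i := fun z₁ z₂ t y hy i h1 h2 => by
    rw [glue_of_ne _ _ _ ⟨fun h => h1 (congrArg Fin.val h), fun h => h2 (congrArg Fin.val h)⟩]
    exact hy _
  have key := laurent_eq_of_slices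
    (fun k K => blockCoeff B φ u w n p q (glue P S k.1 k.2 K))
    (fun k K => f (glue P S k.1 k.2 K))
    (fun k K => blockCoeff B φ u w n p (q + 1) (glue P S k.1 k.2 K))
    (fun z₁ z₂ y => R.eval (shiftBlock P q (glue P S z₁ z₂ y)))
    (fun t i => torusRadius n p q t i)
    (fun t ht i => torusRadius_pos ht i.1.2 fun h => i.2.1 (Fin.ext h))
    (fun z₁ z₂ y h1 h2 h3 hy => by
      have := hf (glue P S z₁ z₂ y) (blockRegion_of_torus hpq h2 h3
        (by rw [← hP, glue_left, h1]) (by rw [← hS, glue_right hne])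
        (hnorm _ _ _ _ hy))
      rw [← (glueEquiv hne).hasSum_iff] at this
      refine this.congr_fun fun x => ?_
      simp only [Function.comp_apply, glueEquiv, Equiv.coe_fn_mk]
      rw [mon_glue hne])
    (fun z₁ z₂ y h1 h2 h3 h4 h5 hy => by
      have := h (glue P S z₁ (z₂ - z₁) y) (blockRegion_succ_of_torus hpq h2 h3
        (by rw [← hP, glue_left, h1]) (by rwa [← hS, glue_right hne])
        (by rwa [← hS, glue_right hne]) (hnorm _ _ _ _ hy))
      rw [← (glueEquiv hne).hasSum_iff] at this
      rw [← shiftBlock_succ_glue]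
      refine this.congr_fun fun x => ?_
      simp only [Function.comp_apply, glueEquiv, Equiv.coe_fn_mk]
      rw [mon_glue hne])
    (fun K => by
      have hK : ∀ (k : ℤ × ℤ) (i : ℕ), i ≠ p → i ≠ p + q + 1 →
          extZ (glue P S k.1 k.2 K) i = extZ (glue P S 0 0 K) i := fun k i h1 h2 => by
        by_cases hi : i < n
        · have h3 : (⟨i, hi⟩ : Fin n) ≠ P ∧ (⟨i, hi⟩ : Fin n) ≠ S :=
            ⟨fun h => h1 (congrArg Fin.val h), fun h => h2 (congrArg Fin.val h)⟩
          rw [extZ_of_lt _ hi, extZ_of_lt _ hi, glue_of_ne _ _ _ h3, glue_of_ne _ _ _ h3]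
        · rw [extZ, extZ, dif_neg hi, dif_neg hi]
      have hKP : ∀ k : ℤ × ℤ, extZ (glue P S k.1 k.2 K) p = k.1 := fun k => by
        rw [extZ_of_lt _ P.2]
        exact glue_left _ _ _
      have hKS : ∀ k : ℤ × ℤ, extZ (glue P S k.1 k.2 K) (p + q + 1) = k.2 := fun k => by
        rw [extZ_of_lt _ hpq]
        exact glue_right hne _ _ _
      have hlt : ∀ i : Fin p, (i : ℕ) ≠ p + q + 1 := fun i => by omega
      set K' : ℕ → ℤ := extZ (glue P S 0 0 K)
      obtain ⟨Q, hQ1, hQ2⟩ := exists_YsR_assoc B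
        (hφ.comp_compLin B p (fun i : Fin p => u i) fun i : Fin p => K' i) (iterV A u K' p q)
        (u (p + q + 1)) (ysProd B u K' (p + q + 2) (n - (p + q + 2)) w)
      refine ⟨Q, fun z₁ z₂ h2 h3 => (hQ1 z₁ z₂ h2 h3).congr_fun fun k => ?_,
        fun z₁ x h2 h3 => (hQ2 z₁ x h2 h3).congr_fun fun k => ?_⟩
      · rw [blockCoeff, hKP, show n - (p + q + 1) = n - (p + q + 2) + 1 by omega, ysProd, hKS,
          iterV_congr u p q fun i h1 h2 => hK k i (by omega) (by omega),
          ysProd_congr B u (p + q + 1 + 1) _ w fun i h1 => hK k i (by omega) (by omega)]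
        simp only [hK k _ (ne_of_lt (Fin.is_lt _)) (hlt _)]
        rfl
      · rw [blockCoeff, hKP, iterV, hKS,
          iterV_congr u p q fun i h1 h2 => hK k i (by omega) (by omega),
          ysProd_congr B u (p + (q + 1) + 1) _ w fun i h1 => hK k i (by omega) (by omega)]
        simp only [hK k _ (ne_of_lt (Fin.is_lt _)) (hlt _)]
        rfl)
  have hc : blockCoeff B φ u w n p q = f := by
    funext k
    obtain ⟨x, rfl⟩ := (glueEquiv hne).surjective k
    exact congrFun (congrFun key x.1) x.2
  rw [hc]
  exact fun z hz => hf z hz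

end Step

/-! ### Products of left and opposite right vertex operators -/

section Prefix

variable {V : Type*} [AddCommGroup V] [Module ℂ V]
variable {W : Type*} [AddCommGroup W] [Module ℂ W]
variable {A : MOSVA V} (B : Bimod A W)

theorem compApply_add {M : Type*} (p c : ℕ) (f : ℕ → M → M) (w : M) {n : ℕ} (h : n = p + c) :
    compApply n (fun i : Fin n => f i) w =
      compApply p (fun i : Fin p => f i) (compApply c (fun j : Fin c => f (p + j)) w) := by
  induction p generalizing f n with
  | zero =>
    obtain rfl : n = c := by omega
    simp [compApply]
  | succ p ih =>
    obtain rfl : n = p + c + 1 := by omega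
    have := ih (fun i => f (i + 1)) rfl
    simp only [add_right_comm p _ 1] at this
    simp only [compApply, Fin.val_succ, Fin.val_zero, this]

theorem compApply_YsR (u : ℕ → V) (k : ℕ → ℤ) (i c : ℕ) (w : W) :
    compApply c (fun j : Fin c => fun x => B.YsR (u (i + j)) x (k (i + j))) w =
      ysProd B u k i c w := by
  induction c generalizing i with
  | zero => rfl
  | succ c ih =>
    rw [ysProd, ← ih]
    simp only [compApply, Fin.val_succ, Fin.val_zero, add_zero, add_assoc, add_comm 1]

/-- Every series with an iterated block expands the same rational function. -/
theorem exists_hasSum_blockCoeff {φ : W →ₗ[ℂ] ℂ} (hφ : InGradedDual B.gr.proj φ)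
    (u : ℕ → V) (w : W) {n p : ℕ} (hp : p < n) :
    ∃ R : RatFn (Fin n), ∀ z, BlockRegion (⟨p, hp⟩ : Fin n) 0 z →
      HasSum (fun k => blockCoeff B φ u w n p 0 k * mon z k)
        (R.eval (shiftBlock ⟨p, hp⟩ 0 z)) := by
  obtain ⟨m, rfl⟩ : ∃ m, n = p + m + 1 := ⟨n - p - 1, by omega⟩
  obtain ⟨R, hR⟩ := hasSum_blockCoeff_top B hφ u w p m
  have h : ∀ d q, q + d = m → ∀ z, BlockRegion (⟨p, hp⟩ : Fin (p + m + 1)) q z →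
      HasSum (fun k => blockCoeff B φ u w (p + m + 1) p q k * mon z k)
        (R.eval (shiftBlock ⟨p, hp⟩ q z)) := by
    intro d
    induction d with
    | zero =>
      rintro q rfl
      exact hR
    | succ d ih =>
      intro q hq
      exact hasSum_blockCoeff_of_succ B hφ u w (by omega) R (ih (q + 1) (by omega))
  exact ⟨R, h m 0 (by omega)⟩

theorem blockCoeff_zero (φ : W →ₗ[ℂ] ℂ) {n l : ℕ} (hl : l < n) (u : ℕ → V) (w : W)
    (k : Fin n → ℤ) :
    blockCoeff B φ u w n l 0 k =
      φ (compApply n (patOps B (prefixPat n l) (fun i => u i) k) w) := by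
  let f : ℕ → W → W := fun i x =>
    if i < l then B.YL (u i) x (extZ k i) else B.YsR (u i) x (extZ k i)
  have h1 : patOps B (prefixPat n l) (fun i => u i) k = fun i : Fin n => f i := by
    funext i
    have h2 : extZ k (i : ℕ) = k i := extZ_of_lt k i.2
    by_cases hi : (i : ℕ) < l <;> simp [patOps, prefixPat, f, hi, h2]
  rw [h1, compApply_add l (n - l) f w (by omega), blockCoeff, ylProd, compLin_apply]
  simp only [f, Fin.is_lt, if_true, add_lt_iff_neg_left, not_lt_zero, if_false, compApply_YsR]
  rw [show n - l = n - (l + 1) + 1 by omega]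
  rfl

end Prefix

/-- Let `V` be a meromorphic open-string vertex algebra and `W` a
`V`-bimodule. Then for every positive integer `n`, every `l = 0,…,n`, all
`u₁,…,uₙ ∈ V`, `w ∈ W` and `w' ∈ W'`, the series
`⟨w', Y_W^L(u₁,z₁)⋯Y_W^L(u_l,z_l)Y_W^{s(R)}(u_{l+1},z_{l+1})⋯Y_W^{s(R)}(uₙ,zₙ)w⟩`
converges absolutely when `|z₁| > ⋯ > |zₙ| > 0` to a rational function in
`z₁,…,zₙ` with the only possible poles at `z_i = 0` and `z_i = z_j`. -/
theorem statement0 {V : Type*} [AddCommGroup V] [Module ℂ V]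
    {W : Type*} [AddCommGroup W] [Module ℂ W]
    (A : MOSVA V) (B : Bimod A W)
    (n : ℕ) (hn : 0 < n) (l : ℕ) (hl : l ≤ n)
    (u : Fin n → V) (w : W) (φ : W →ₗ[ℂ] ℂ) (hφ : InGradedDual B.gr.proj φ) :
    ∃ R : RatFn (Fin n), ∀ z : Fin n → ℂ, OrderedPos z →
      AbsConvTo (fun k : Fin n → ℤ =>
          φ (compApply n (patOps B (prefixPat n l) u k) w) * ∏ i, z i ^ (-(k i) - 1))
        (R.eval z) := by
  rcases hl.lt_or_eq with hl | rfl
  · let u' : ℕ → V := fun i => if h : i < n then u ⟨i, h⟩ else 0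
    have hu : (fun i : Fin n => u' i) = u := funext fun i => dif_pos i.2
    obtain ⟨R, hR⟩ := exists_hasSum_blockCoeff B hφ u' w hl
    refine ⟨R, fun z hz => AbsConvTo.of_hasSum ?_⟩
    have h1 := hR z (BlockRegion.of_orderedPos _ hz)
    rw [shiftBlock_zero] at h1
    refine h1.congr_fun fun k => ?_
    rw [blockCoeff_zero B φ hl, hu, mon]
  · have h1 : ∀ k : Fin l → ℤ, patOps B (prefixPat l l) u k = fun i x => B.YL (u i) x (k i) := by
      intro k
      funext i
      simp [patOps, prefixPat]
    simpa only [h1] using B.rationalityL l u w φ hφ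

end VA
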